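/- arXiv:1605.02714 — 2 statements merged into one kernel-verified Lean document; each statement's English description precedes it below -/
import Mathlib

section
/- Let (PA_t)_{t≥1} be a preferential attachment model and fix σ > 1/(3−τ) with τ = 3 + δ/m. There exists a constant B ∈ (0,∞) such that for every i ∈ [t/2], P(D_t(i) ≥ (1+B)(log t)^σ | D_{t/2}(i) < (log t)^σ) = o(1/t), uniformly in i. -/
open Finset Filter

open scoped Classical

noncomputable section

/-- A realization of the attachment choices of the preferential attachment model of
size `t` with `m` edges per vertex: `ξ s j` is the vertex (0-based; vertex `v : Fin t`
represents the 1-based vertex `v.val + 1 ∈ [t]`) to which the `(j+1)`-st edge of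
vertex `s.val + 1` is attached. -/
abbrev PAConfig (t m : ℕ) : Type := Fin t → Fin m → Fin t

/-- The degree `D_{s,j}(v)` of the 1-based vertex `v` after the first `j` edges of the
1-based vertex `s` have been attached (a self-loop contributes 2 to the degree). -/
def paDeg {t m : ℕ} (ξ : PAConfig t m) (s j v : ℕ) : ℕ :=
  ∑ ui : Fin t × Fin m,
    if ui.1.val + 1 < s ∨ (ui.1.val + 1 = s ∧ ui.2.val + 1 ≤ j) then
      (if (ξ ui.1 ui.2).val + 1 = v then 1 else 0) + (if ui.1.val + 1 = v then 1 else 0)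
    else 0

/-- The normalizing constant `c_{s,j} = [m(s-1)+(j-1)](2+δ/m) + 1 + δ/m`
(`s`, `j` 1-based). -/
def paC (m : ℕ) (δ : ℝ) (s j : ℕ) : ℝ :=
  ((m : ℝ) * ((s : ℝ) - 1) + ((j : ℝ) - 1)) * (2 + δ / m) + 1 + δ / m

/-- The probability of the realization `ξ` of the preferential attachment model
`PA_t(m, δ)`: the product over all edges of the conditional attachment probabilities
`(D_{s,j-1}(v) + 1 + jδ/m)/c_{s,j}` (self-loop) resp. `(D_{s,j-1}(v) + δ)/c_{s,j}`
(attachment to an older vertex `v < s`). -/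
def paWeight (t m : ℕ) (δ : ℝ) (ξ : PAConfig t m) : ℝ :=
  ∏ s : Fin t, ∏ j : Fin m,
    if (ξ s j).val = s.val then
      ((paDeg ξ (s.val + 1) j.val (s.val + 1) : ℝ) + 1 + ((j.val : ℝ) + 1) * δ / m) /
        paC m δ (s.val + 1) (j.val + 1)
    else if (ξ s j).val < s.val then
      ((paDeg ξ (s.val + 1) j.val ((ξ s j).val + 1) : ℝ) + δ) /
        paC m δ (s.val + 1) (j.val + 1)
    else 0

/-- The probability of an event under the preferential attachment model `PA_t(m, δ)`. -/
def paProb (t m : ℕ) (δ : ℝ) (E : PAConfig t m → Prop) : ℝ :=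
  ∑ ξ ∈ (univ : Finset (PAConfig t m)).filter E, paWeight t m δ ξ

/-- The expectation of a random variable under `PA_t(m, δ)`. -/
def paExp (t m : ℕ) (δ : ℝ) (f : PAConfig t m → ℝ) : ℝ :=
  ∑ ξ : PAConfig t m, paWeight t m δ ξ * f ξ

/-- Adjacency in the graph `PA_t`. -/
def paAdj {t m : ℕ} (ξ : PAConfig t m) (u v : Fin t) : Prop :=
  ∃ j : Fin m, ξ u j = v ∨ ξ v j = u

/-- The degree `D_t(v)` of the vertex `v` at time `t`, i.e. in the graph `PA_t`. -/
def paDegT {t m : ℕ} (ξ : PAConfig t m) (v : Fin t) : ℕ := paDeg ξ t m (v.val + 1)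

/-- There is a walk of length `k` from `u` to `v` in the graph with adjacency relation `A`. -/
def reachIn {V : Type*} (A : V → V → Prop) (u v : V) (k : ℕ) : Prop :=
  ∃ p : ℕ → V, p 0 = u ∧ p k = v ∧ ∀ i < k, A (p i) (p (i + 1))

/-- Graph distance (`⊤` if there is no path). -/
def graphDist {V : Type*} (A : V → V → Prop) (u v : V) : ℕ∞ :=
  ⨅ (k : ℕ) (_ : reachIn A u v k), (k : ℕ∞)

/-- Graph diameter: the maximal graph distance between pairs of vertices. -/
def graphDiam {V : Type*} (A : V → V → Prop) : ℕ∞ :=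
  ⨆ (u : V) (v : V), graphDist A u v

/-- The position of an edge in the order in which the edges are attached. -/
def edgeIndex {t m : ℕ} (e : Fin t × Fin m) : ℕ := e.1.val * m + e.2.val

/-- The degree of the 0-based vertex `v` after the first `n` edges have been attached. -/
def edgeDeg {t m : ℕ} (ξ : PAConfig t m) (n v : ℕ) : ℕ :=
  ∑ e : Fin t × Fin m,
    if edgeIndex e < n then
      (if (ξ e.1 e.2).val = v then 1 else 0) + (if e.1.val = v then 1 else 0)
    else 0

/-- The conditional probability that the edge `e` is attached to the 0-based vertex `x`. -/
def attachProb {t m : ℕ} (δ : ℝ) (ξ : PAConfig t m) (e : Fin t × Fin m) (x : ℕ) : ℝ :=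
  if x = e.1.val then
    ((edgeDeg ξ (edgeIndex e) e.1 : ℝ) + 1 + ((e.2.val : ℝ) + 1) * δ / m) /
      paC m δ (e.1.val + 1) (e.2.val + 1)
  else if x < e.1.val then
    ((edgeDeg ξ (edgeIndex e) x : ℝ) + δ) / paC m δ (e.1.val + 1) (e.2.val + 1)
  else 0

/-- The probability of the first `n` attachments of `ξ`. -/
def partialWeight {t m : ℕ} (δ : ℝ) (n : ℕ) (ξ : PAConfig t m) : ℝ :=
  ∏ e : Fin t × Fin m, if edgeIndex e < n then attachProb δ ξ e (ξ e.1 e.2) else 1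

/-- The configuration `ξ` with the edge `e` redirected to `x`. -/
def redirect {t m : ℕ} (ξ : PAConfig t m) (e : Fin t × Fin m) (x : Fin t) : PAConfig t m :=
  Function.update ξ e.1 (Function.update (ξ e.1) e.2 x)

section

variable {t m : ℕ}

lemma edgeIndex_injective : Function.Injective (edgeIndex (t := t) (m := m)) := by
  rintro ⟨a, b⟩ ⟨c, d⟩ h
  simp only [edgeIndex] at h
  have hb := b.2
  have hd := d.2
  have h1 : a.val = c.val := by
    rcases lt_trichotomy a.val c.val with h' | h' | h'
    · nlinarith
    · exact h'
    · nlinarith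
  have h2 : b.val = d.val := by
    rw [h1] at h
    omega
  exact Prod.ext (Fin.ext h1) (Fin.ext h2)

lemma edgeIndex_lt (e : Fin t × Fin m) : edgeIndex e < t * m := by
  have h1 : e.1.val + 1 ≤ t := e.1.2
  have h2 := e.2.2
  unfold edgeIndex
  nlinarith

lemma exists_edgeIndex_eq {n : ℕ} (hn : n < t * m) : ∃ e : Fin t × Fin m, edgeIndex e = n := by
  have hm : 0 < m := Nat.pos_of_ne_zero (by rintro rfl; simp at hn)
  refine ⟨(⟨n / m, (Nat.div_lt_iff_lt_mul hm).2 hn⟩, ⟨n % m, Nat.mod_lt _ hm⟩), ?_⟩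
  simp only [edgeIndex]
  exact Nat.div_add_mod' n m

lemma edgeIndex_lt_iff (e : Fin t × Fin m) {s j : ℕ} (hj : j ≤ m) :
    edgeIndex e < s * m + j ↔
      e.1.val + 1 < s + 1 ∨ (e.1.val + 1 = s + 1 ∧ e.2.val + 1 ≤ j) := by
  have h2 := e.2.2
  unfold edgeIndex
  rcases lt_trichotomy e.1.val s with h | h | h
  · simp only [Nat.add_lt_add_iff_right, h, true_or, iff_true]
    nlinarith
  · subst h
    simp
  · have : ¬ (e.1.val + 1 < s + 1 ∨ (e.1.val + 1 = s + 1 ∧ e.2.val + 1 ≤ j)) := by omega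
    simp only [this, iff_false, not_lt]
    nlinarith

lemma paDeg_eq_edgeDeg (ξ : PAConfig t m) {s j : ℕ} (hj : j ≤ m) (v : ℕ) :
    paDeg ξ (s + 1) j (v + 1) = edgeDeg ξ (s * m + j) v := by
  unfold paDeg edgeDeg
  refine Finset.sum_congr rfl fun e _ => ?_
  simp only [edgeIndex_lt_iff e hj, Nat.add_right_cancel_iff]

lemma paDeg_end_eq_edgeDeg (ξ : PAConfig t m) {s : ℕ} (hs : 1 ≤ s) (v : ℕ) :
    paDeg ξ s m (v + 1) = edgeDeg ξ (s * m) v := by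
  obtain ⟨s, rfl⟩ := Nat.exists_eq_add_of_le' hs
  rw [paDeg_eq_edgeDeg ξ le_rfl, Nat.succ_mul]

lemma paWeight_eq_partialWeight (δ : ℝ) (ξ : PAConfig t m) :
    paWeight t m δ ξ = partialWeight δ (t * m) ξ := by
  unfold paWeight partialWeight
  rw [Fintype.prod_prod_type]
  refine Finset.prod_congr rfl fun s _ => Finset.prod_congr rfl fun j _ => ?_
  rw [if_pos (edgeIndex_lt _)]
  simp only [attachProb, edgeIndex, paDeg_eq_edgeDeg ξ j.2.le]

lemma redirect_self (ξ : PAConfig t m) (e : Fin t × Fin m) (x : Fin t) :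
    redirect ξ e x e.1 e.2 = x := by
  simp [redirect]

lemma redirect_of_ne (ξ : PAConfig t m) {e e' : Fin t × Fin m} (h : e' ≠ e) (x : Fin t) :
    redirect ξ e x e'.1 e'.2 = ξ e'.1 e'.2 := by
  unfold redirect
  by_cases h1 : e'.1 = e.1
  · have h2 : e'.2 ≠ e.2 := fun h2 => h (Prod.ext h1 h2)
    rw [h1]
    simp [h2]
  · simp [h1]

lemma redirect_redirect_self (ξ : PAConfig t m) (e : Fin t × Fin m) (x : Fin t) :
    redirect (redirect ξ e x) e (ξ e.1 e.2) = ξ := by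
  simp [redirect]

lemma sum_sum_redirect (e : Fin t × Fin m) (G : PAConfig t m → ℝ) :
    ∑ ξ, ∑ x, G (redirect ξ e x) = t * ∑ ξ, G ξ := by
  let f : PAConfig t m × Fin t → PAConfig t m × Fin t :=
    fun p => (redirect p.1 e p.2, p.1 e.1 e.2)
  have hf : Function.Involutive f := fun p => by
    simp only [f, redirect_redirect_self, redirect_self]
  have h : ∑ p : PAConfig t m × Fin t, G (redirect p.1 e p.2) =
      ∑ p : PAConfig t m × Fin t, G p.1 :=
    Equiv.sum_comp (hf.toPerm f) fun p : PAConfig t m × Fin t => G p.1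
  rw [← Fintype.sum_prod_type' (fun ξ x => G (redirect ξ e x)), h, Fintype.sum_prod_type, Finset.mul_sum]
  simp

lemma edgeDeg_redirect (ξ : PAConfig t m) {e : Fin t × Fin m} {n : ℕ} (hn : n ≤ edgeIndex e)
    (x : Fin t) (v : ℕ) : edgeDeg (redirect ξ e x) n v = edgeDeg ξ n v := by
  unfold edgeDeg
  refine Finset.sum_congr rfl fun e' _ => ?_
  by_cases h : edgeIndex e' < n
  · have hne : e' ≠ e := by
      rintro rfl
      omega
    rw [if_pos h, if_pos h, redirect_of_ne ξ hne]
  · rw [if_neg h, if_neg h]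

lemma edgeDeg_succ (ξ : PAConfig t m) (e : Fin t × Fin m) (v : ℕ) :
    edgeDeg ξ (edgeIndex e + 1) v = edgeDeg ξ (edgeIndex e) v +
      ((if (ξ e.1 e.2).val = v then 1 else 0) + (if e.1.val = v then 1 else 0)) := by
  unfold edgeDeg
  rw [← Finset.add_sum_erase _ _ (Finset.mem_univ e),
    ← Finset.add_sum_erase (a := e) (f := fun e' => if edgeIndex e' < edgeIndex e then _ else _)
      _ (Finset.mem_univ e)]
  rw [if_pos (Nat.lt_succ_self _), if_neg (lt_irrefl _), zero_add, add_comm]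
  congr 1
  refine Finset.sum_congr rfl fun e' he' => ?_
  have h : edgeIndex e' ≠ edgeIndex e := fun h => (Finset.mem_erase.1 he').1 (edgeIndex_injective h)
  simp only [show edgeIndex e' < edgeIndex e + 1 ↔ edgeIndex e' < edgeIndex e by omega]

lemma attachProb_redirect (δ : ℝ) (ξ : PAConfig t m) {e e' : Fin t × Fin m}
    (h : edgeIndex e' ≤ edgeIndex e) (x : Fin t) (y : ℕ) :
    attachProb δ (redirect ξ e x) e' y = attachProb δ ξ e' y := by
  simp only [attachProb, edgeDeg_redirect ξ h]

lemma partialWeight_succ_redirect (δ : ℝ) (ξ : PAConfig t m) (e : Fin t × Fin m) (x : Fin t) :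
    partialWeight δ (edgeIndex e + 1) (redirect ξ e x) =
      partialWeight δ (edgeIndex e) ξ * attachProb δ ξ e x := by
  unfold partialWeight
  rw [← Finset.mul_prod_erase _ _ (Finset.mem_univ e),
    ← Finset.mul_prod_erase (a := e) (f := fun e' => if edgeIndex e' < edgeIndex e then _ else _)
      _ (Finset.mem_univ e)]
  rw [if_pos (Nat.lt_succ_self _), if_neg (lt_irrefl _), one_mul, mul_comm, redirect_self,
    attachProb_redirect δ ξ le_rfl]
  congr 1
  refine Finset.prod_congr rfl fun e' he' => ?_
  have hne := (Finset.mem_erase.1 he').1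
  have h : edgeIndex e' ≠ edgeIndex e := fun h => hne (edgeIndex_injective h)
  simp only [show edgeIndex e' < edgeIndex e + 1 ↔ edgeIndex e' < edgeIndex e by omega]
  split_ifs with hlt
  · rw [redirect_of_ne ξ hne, attachProb_redirect δ ξ hlt.le]
  · rfl

lemma le_edgeDeg (ξ : PAConfig t m) (v : Fin t) {k n : ℕ} (hk : k ≤ m) (hn : v.val * m + k ≤ n) :
    k ≤ edgeDeg ξ n v := by
  unfold edgeDeg
  rw [Fintype.sum_prod_type]
  refine le_trans ?_ (Finset.single_le_sum (f := fun s : Fin t => ∑ j : Fin m,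
    if edgeIndex (s, j) < n then
      (if (ξ s j).val = v.val then 1 else 0) + (if s.val = v.val then 1 else 0)
    else 0) (fun _ _ => Nat.zero_le _) (Finset.mem_univ v))
  let f : Fin m → ℕ := fun j => if edgeIndex (v, j) < n then
    (if (ξ v j).val = v.val then 1 else 0) + (if v.val = v.val then 1 else 0) else 0
  calc k = ∑ _j : Fin k, 1 := by simp
    _ ≤ ∑ j : Fin k, f (Fin.castLEEmb hk j) := by
        refine Finset.sum_le_sum fun j _ => ?_
        have hj := j.2
        have : edgeIndex (v, Fin.castLE hk j) < n := by
          simp only [edgeIndex, Fin.val_castLE]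
          omega
        simp [f, this]
    _ = ∑ j ∈ Finset.univ.map (Fin.castLEEmb hk), f j := (Finset.sum_map _ _ f).symm
    _ ≤ ∑ j, f j := Finset.sum_le_sum_of_subset (Finset.subset_univ _)

lemma le_paC {δ : ℝ} (hm : 1 ≤ m) (hδ : -(m : ℝ) < δ) (e : Fin t × Fin m) :
    (edgeIndex e : ℝ) < paC m δ (e.1.val + 1) (e.2.val + 1) := by
  have hm' : (0 : ℝ) < m := by exact_mod_cast hm
  have h : -1 < δ / m := by rw [lt_div_iff₀ hm']; linarith
  have h0 : (0 : ℝ) ≤ edgeIndex e := Nat.cast_nonneg _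
  have : paC m δ (e.1.val + 1) (e.2.val + 1) = edgeIndex e * (2 + δ / m) + 1 + δ / m := by
    simp only [paC, edgeIndex]
    push_cast
    ring
  rw [this]
  nlinarith

lemma attachProb_nonneg {δ : ℝ} (hm : 1 ≤ m) (hδ : -(m : ℝ) < δ) (ξ : PAConfig t m)
    (e : Fin t × Fin m) (x : ℕ) : 0 ≤ attachProb δ ξ e x := by
  have hm' : (0 : ℝ) < m := by exact_mod_cast hm
  have h : -1 < δ / m := by rw [lt_div_iff₀ hm']; linarith
  have hc : 0 ≤ paC m δ (e.1.val + 1) (e.2.val + 1) :=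
    (Nat.cast_nonneg _).trans (le_paC hm hδ e).le
  unfold attachProb
  split_ifs with h1 h2
  · refine div_nonneg ?_ hc
    have hd : (e.2.val : ℝ) ≤ edgeDeg ξ (edgeIndex e) e.1 := by
      exact_mod_cast le_edgeDeg ξ e.1 e.2.2.le le_rfl
    have h0 : (0 : ℝ) ≤ e.2.val := Nat.cast_nonneg _
    rw [mul_div_assoc]
    nlinarith
  · refine div_nonneg ?_ hc
    have hd : (m : ℝ) ≤ edgeDeg ξ (edgeIndex e) x := by
      have h3 : x * m + m ≤ edgeIndex e := by
        unfold edgeIndex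
        nlinarith
      exact_mod_cast le_edgeDeg ξ ⟨x, h2.trans e.1.2⟩ le_rfl h3
    linarith
  · exact le_rfl

lemma partialWeight_nonneg {δ : ℝ} (hm : 1 ≤ m) (hδ : -(m : ℝ) < δ) (n : ℕ) (ξ : PAConfig t m) :
    0 ≤ partialWeight δ n ξ := by
  refine Finset.prod_nonneg fun e _ => ?_
  split_ifs
  · exact attachProb_nonneg hm hδ ξ e _
  · exact zero_le_one

lemma target_le_of_partialWeight_ne_zero {δ : ℝ} {n : ℕ} {ξ : PAConfig t m}
    (hW : partialWeight δ n ξ ≠ 0) {e : Fin t × Fin m} (he : edgeIndex e < n) :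
    ξ e.1 e.2 ≤ e.1 := by
  by_contra hlt
  refine hW (Finset.prod_eq_zero (Finset.mem_univ e) ?_)
  have hlt : e.1.val < (ξ e.1 e.2).val := not_le.1 hlt
  rw [if_pos he, attachProb, if_neg (by omega), if_neg (by omega)]

lemma card_edgeIndex_lt {n : ℕ} (hn : n ≤ t * m) :
    #{e : Fin t × Fin m | edgeIndex e < n} = n := by
  rw [← Finset.card_image_of_injective _ edgeIndex_injective]
  convert Finset.card_range n
  ext k
  simp only [Finset.mem_image, Finset.mem_filter, Finset.mem_univ, true_and, Finset.mem_range]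
  constructor
  · rintro ⟨e, he, rfl⟩
    exact he
  · intro hk
    obtain ⟨e, rfl⟩ := exists_edgeIndex_eq (hk.trans_le hn)
    exact ⟨e, hk, rfl⟩

lemma sum_edgeDeg (ξ : PAConfig t m) {n : ℕ} (hn : n ≤ t * m) :
    ∑ v : Fin t, edgeDeg ξ n v = 2 * n := by
  unfold edgeDeg
  rw [Finset.sum_comm]
  have : ∀ e : Fin t × Fin m, (∑ v : Fin t, if edgeIndex e < n then
      (if (ξ e.1 e.2).val = v.val then 1 else 0) + (if e.1.val = v.val then 1 else 0)
      else 0) = if edgeIndex e < n then 2 else 0 := by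
    intro e
    split_ifs
    · simp [Finset.sum_add_distrib, ← Fin.ext_iff]
    · simp
  rw [Finset.sum_congr rfl fun e _ => this e, ← Finset.sum_filter, Finset.sum_const,
    card_edgeIndex_lt hn, smul_eq_mul, mul_comm]

lemma edgeDeg_eq_zero {δ : ℝ} {ξ : PAConfig t m} {e : Fin t × Fin m}
    (hW : partialWeight δ (edgeIndex e) ξ ≠ 0) {v : ℕ} (hv : e.1.val < v) :
    edgeDeg ξ (edgeIndex e) v = 0 := by
  refine Finset.sum_eq_zero fun e' _ => ?_
  split_ifs with h1 h2 h3 h3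
  all_goals try rfl
  all_goals
    exfalso
    have h4 : (ξ e'.1 e'.2).val ≤ e'.1.val := target_le_of_partialWeight_ne_zero hW h1
    have h5 := (edgeIndex_lt_iff e' (s := e.1.val) e.2.2.le).1 h1
    omega

lemma sum_attachProb {δ : ℝ} (hm : 1 ≤ m) (hδ : -(m : ℝ) < δ) {ξ : PAConfig t m}
    {e : Fin t × Fin m} (hW : partialWeight δ (edgeIndex e) ξ ≠ 0) :
    ∑ x : Fin t, attachProb δ ξ e x = 1 := by
  have hm' : (m : ℝ) ≠ 0 := by
    have : m ≠ 0 := by omega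
    exact_mod_cast this
  have hc : 0 < paC m δ (e.1.val + 1) (e.2.val + 1) :=
    (Nat.cast_nonneg _).trans_lt (le_paC hm hδ e)
  have hx : ∀ x : Fin t, attachProb δ ξ e x = ((edgeDeg ξ (edgeIndex e) x : ℝ) +
      ((if x < e.1 then δ else 0) + (if x = e.1 then 1 + ((e.2.val : ℝ) + 1) * δ / m else 0))) /
      paC m δ (e.1.val + 1) (e.2.val + 1) := by
    intro x
    rcases lt_trichotomy x e.1 with h | h | h
    · have h' : x.val < e.1.val := h
      simp [attachProb, h', h'.ne, h, h.ne]
    · subst h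
      simp [attachProb, add_assoc]
    · have h' : e.1.val < x.val := h
      simp [attachProb, h'.ne', h'.not_gt, h.ne', h.not_gt, edgeDeg_eq_zero hW h']
  rw [Finset.sum_congr rfl fun x _ => hx x, ← Finset.sum_div, div_eq_one_iff_eq hc.ne',
    Finset.sum_add_distrib, Finset.sum_add_distrib, ← Nat.cast_sum,
    sum_edgeDeg ξ (edgeIndex_lt e).le, ← Finset.sum_filter, Finset.sum_const,
    Finset.sum_ite_eq' Finset.univ e.1, if_pos (Finset.mem_univ _)]
  have hcard : #{x : Fin t | x < e.1} = e.1.val := by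
    rw [← Fin.card_Iio e.1]
    congr 1
    ext x
    simp
  rw [hcard]
  simp only [paC, edgeIndex]
  push_cast
  field_simp
  ring

lemma sum_partialWeight_succ_le {δ : ℝ} (hm : 1 ≤ m) (hδ : -(m : ℝ) < δ) (e : Fin t × Fin m)
    (g g' : PAConfig t m → ℝ)
    (h : ∀ ξ, partialWeight δ (edgeIndex e) ξ ≠ 0 →
      ∑ x : Fin t, attachProb δ ξ e x * g' (redirect ξ e x) ≤ g ξ) :
    t * ∑ ξ, partialWeight δ (edgeIndex e + 1) ξ * g' ξ ≤
      ∑ ξ, partialWeight δ (edgeIndex e) ξ * g ξ := by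
  rw [← sum_sum_redirect e]
  refine Finset.sum_le_sum fun ξ _ => ?_
  simp only [partialWeight_succ_redirect, mul_assoc, ← Finset.mul_sum]
  by_cases hW : partialWeight δ (edgeIndex e) ξ = 0
  · simp [hW]
  · exact mul_le_mul_of_nonneg_left (h ξ hW) (partialWeight_nonneg hm hδ _ ξ)

/-- A family of functionals satisfying the one-step supermartingale inequality has nonincreasing
expectations; the power of `t` accounts for the edges that are not yet attached. -/
lemma sum_partialWeight_add_le {δ : ℝ} (hm : 1 ≤ m) (hδ : -(m : ℝ) < δ) (n₀ : ℕ)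
    (g : ℕ → PAConfig t m → ℝ)
    (h : ∀ e : Fin t × Fin m, n₀ ≤ edgeIndex e → ∀ ξ, partialWeight δ (edgeIndex e) ξ ≠ 0 →
      ∑ x : Fin t, attachProb δ ξ e x * g (edgeIndex e + 1) (redirect ξ e x) ≤
        g (edgeIndex e) ξ) (k : ℕ) (hk : n₀ + k ≤ t * m) :
    (t : ℝ) ^ k * ∑ ξ, partialWeight δ (n₀ + k) ξ * g (n₀ + k) ξ ≤
      ∑ ξ, partialWeight δ n₀ ξ * g n₀ ξ := by
  induction k with
  | zero => simp
  | succ k ih =>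
    refine le_trans ?_ (ih (by omega))
    obtain ⟨e, he⟩ := exists_edgeIndex_eq (show n₀ + k < t * m by omega)
    rw [pow_succ, mul_assoc]
    refine mul_le_mul_of_nonneg_left ?_ (by positivity)
    have := sum_partialWeight_succ_le hm hδ e _ _ (h e (by omega))
    rwa [he] at this

lemma sum_attachProb_mul_exp_le {δ : ℝ} (hm : 1 ≤ m) (hδ : -(m : ℝ) < δ) (hδ₀ : δ ≤ 0)
    {ξ : PAConfig t m} {e : Fin t × Fin m} (hW : partialWeight δ (edgeIndex e) ξ ≠ 0)
    {i : Fin t} (hi : i < e.1) {θ : ℝ} (hθ₀ : 0 ≤ θ) (hθ₁ : θ ≤ 1) :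
    ∑ x : Fin t, attachProb δ ξ e x *
        Real.exp (θ * edgeDeg (redirect ξ e x) (edgeIndex e + 1) i) ≤
      Real.exp (θ * (1 + 2 / edgeIndex e) * edgeDeg ξ (edgeIndex e) i) := by
  set d : ℝ := (edgeDeg ξ (edgeIndex e) i : ℝ) with hd
  have hd0 : 0 ≤ d := Nat.cast_nonneg _
  have hi' : i.val < e.1.val := hi
  have hn : (0 : ℝ) < edgeIndex e := by
    have : 0 < edgeIndex e := by
      unfold edgeIndex
      have : 0 < e.1.val * m := Nat.mul_pos (by omega) hm
      omega
    exact_mod_cast this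
  have hx : ∀ x : Fin t, attachProb δ ξ e x *
      Real.exp (θ * edgeDeg (redirect ξ e x) (edgeIndex e + 1) i) =
      Real.exp (θ * d) * (attachProb δ ξ e x +
        if x = i then attachProb δ ξ e i * (Real.exp θ - 1) else 0) := by
    intro x
    rw [edgeDeg_succ, edgeDeg_redirect ξ le_rfl, redirect_self]
    by_cases hxi : x = i
    · subst hxi
      simp only [hi'.ne', if_true, if_false]
      push_cast
      rw [← hd, mul_add, mul_one, Real.exp_add]
      ring
    · have hxi' : x.val ≠ i.val := fun h => hxi (Fin.ext h)
      simp only [hxi, hxi', hi'.ne', if_false]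
      push_cast
      rw [← hd, add_zero, add_zero, mul_comm]
  have hp : attachProb δ ξ e i ≤ d / edgeIndex e := by
    rw [attachProb, if_neg hi'.ne, if_pos hi']
    calc ((edgeDeg ξ (edgeIndex e) i : ℝ) + δ) / paC m δ (e.1.val + 1) (e.2.val + 1)
        ≤ d / paC m δ (e.1.val + 1) (e.2.val + 1) :=
          div_le_div_of_nonneg_right (by linarith) (hn.trans (le_paC hm hδ e)).le
      _ ≤ d / edgeIndex e := div_le_div_of_nonneg_left hd0 hn (le_paC hm hδ e).le
  have hexp : Real.exp θ - 1 ≤ 2 * θ := by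
    have := Real.abs_exp_sub_one_le (x := θ) (by rw [abs_of_nonneg hθ₀]; exact hθ₁)
    rw [abs_of_nonneg hθ₀] at this
    exact (le_abs_self _).trans this
  rw [Finset.sum_congr rfl fun x _ => hx x, ← Finset.mul_sum, Finset.sum_add_distrib,
    sum_attachProb hm hδ hW, Finset.sum_ite_eq' Finset.univ i, if_pos (Finset.mem_univ _)]
  calc Real.exp (θ * d) * (1 + attachProb δ ξ e i * (Real.exp θ - 1))
      ≤ Real.exp (θ * d) * Real.exp (d / edgeIndex e * (2 * θ)) := by
        refine mul_le_mul_of_nonneg_left ?_ (Real.exp_pos _).le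
        have h1 : attachProb δ ξ e i * (Real.exp θ - 1) ≤ d / edgeIndex e * (2 * θ) :=
          mul_le_mul hp hexp (sub_nonneg.2 (Real.one_le_exp hθ₀)) (by positivity)
        linarith [Real.add_one_le_exp (d / edgeIndex e * (2 * θ))]
    _ = Real.exp (θ * (1 + 2 / edgeIndex e) * d) := by
        rw [← Real.exp_add]
        congr 1
        ring

/-- Conditionally on having degree below `L` at time `t / 2`, the degree of `i` at time `t` is at
least `27 * L` with probability at most `exp (-2 * L)`. -/
lemma paProb_degree_growth_le {δ : ℝ} (hm : 1 ≤ m) (hδ : -(m : ℝ) < δ) (hδ₀ : δ ≤ 0)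
    (i : Fin t) (hi : i.val + 1 ≤ t / 2) (L : ℝ) :
    paProb t m δ (fun ξ => 27 * L ≤ (paDegT ξ i : ℝ) ∧
        (paDeg ξ (t / 2) m (i.val + 1) : ℝ) < L) ≤
      Real.exp (-(2 * L)) *
        paProb t m δ (fun ξ => (paDeg ξ (t / 2) m (i.val + 1) : ℝ) < L) := by
  have hs : 1 ≤ t / 2 := by omega
  obtain ⟨n₀, hn₀⟩ : ∃ n₀, n₀ = t / 2 * m := ⟨_, rfl⟩
  have hn₀pos : 0 < n₀ := hn₀ ▸ Nat.mul_pos hs hm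
  have hle : n₀ ≤ t * m := hn₀ ▸ Nat.mul_le_mul_right _ (Nat.div_le_self _ _)
  obtain ⟨k, hk⟩ := Nat.exists_eq_add_of_le hle
  have hN : t * m ≤ 3 * n₀ := by
    rw [hn₀, ← mul_assoc]
    exact Nat.mul_le_mul_right _ (by omega)
  simp only [paProb, paDegT, paDeg_end_eq_edgeDeg _ hs,
    paDeg_end_eq_edgeDeg _ (show 1 ≤ t by omega), paWeight_eq_partialWeight, ← hn₀,
    Finset.sum_filter]
  let χ : PAConfig t m → ℝ := fun ξ => if (edgeDeg ξ n₀ i : ℝ) < L then 1 else 0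
  have hχ₀ : ∀ ξ, 0 ≤ χ ξ := fun ξ => by
    simp only [χ]
    split_ifs <;> norm_num
  have hχ : ∀ e : Fin t × Fin m, n₀ ≤ edgeIndex e → ∀ ξ x, χ (redirect ξ e x) = χ ξ := by
    intro e he ξ x
    simp only [χ, edgeDeg_redirect ξ he]
  let θ : ℕ → ℝ := fun n => ((n₀ : ℝ) * (n₀ + 1)) / (n * (n + 1))
  have hn₀R : (0 : ℝ) < n₀ := by exact_mod_cast hn₀pos
  have hmass : ∑ ξ, partialWeight δ n₀ ξ * χ ξ ≤
      (t : ℝ) ^ k * ∑ ξ, partialWeight δ (t * m) ξ * χ ξ := by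
    have := sum_partialWeight_add_le hm hδ n₀ (fun _ ξ => -χ ξ) (fun e he ξ hW => by
      simp only [hχ e he, ← Finset.sum_mul, sum_attachProb hm hδ hW, one_mul, le_refl]) k hk.ge
    simp only [← hk, mul_neg, Finset.sum_neg_distrib] at this
    linarith
  have hmoment : (t : ℝ) ^ k * ∑ ξ, partialWeight δ (t * m) ξ *
      (Real.exp (θ (t * m) * edgeDeg ξ (t * m) i) * χ ξ) ≤
      ∑ ξ, partialWeight δ n₀ ξ * (Real.exp (θ n₀ * edgeDeg ξ n₀ i) * χ ξ) := by
    have := sum_partialWeight_add_le hm hδ n₀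
      (fun n ξ => Real.exp (θ n * edgeDeg ξ n i) * χ ξ) (fun e he ξ hW => ?_) k hk.ge
    · simpa only [← hk] using this
    simp only [hχ e he, ← mul_assoc, ← Finset.sum_mul]
    refine mul_le_mul_of_nonneg_right ?_ (hχ₀ ξ)
    have hie : i < e.1 := by
      have h1 : t / 2 * m < e.1.val * m + m := by
        rw [← hn₀]
        refine he.trans_lt ?_
        have := e.2.2
        unfold edgeIndex
        omega
      have h2 : t / 2 < e.1.val + 1 := by
        rw [← Nat.succ_mul] at h1
        exact lt_of_mul_lt_mul_right h1 (Nat.zero_le _)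
      exact Fin.lt_def.2 (by omega)
    have heR : (n₀ : ℝ) ≤ edgeIndex e := by exact_mod_cast he
    have heR0 : (0 : ℝ) < edgeIndex e := hn₀R.trans_le heR
    have hθ₁ : θ (edgeIndex e + 1) ≤ 1 := by
      simp only [θ]
      push_cast
      rw [div_le_one (by positivity)]
      nlinarith
    have hθ : θ (edgeIndex e + 1) * (1 + 2 / edgeIndex e) = θ (edgeIndex e) := by
      simp only [θ]
      push_cast
      field_simp
      ring
    rw [← hθ]
    exact sum_attachProb_mul_exp_le hm hδ hδ₀ hW hie (by positivity) hθ₁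
  have hstart : ∑ ξ, partialWeight δ n₀ ξ * (Real.exp (θ n₀ * edgeDeg ξ n₀ i) * χ ξ) ≤
      Real.exp L * ∑ ξ, partialWeight δ n₀ ξ * χ ξ := by
    have hθ : θ n₀ = 1 := div_self (by positivity)
    rw [Finset.mul_sum]
    refine Finset.sum_le_sum fun ξ _ => ?_
    rw [mul_left_comm (Real.exp L)]
    refine mul_le_mul_of_nonneg_left ?_ (partialWeight_nonneg hm hδ _ ξ)
    rw [hθ, one_mul]
    simp only [χ]
    split_ifs with h
    · simpa using h.le
    · simp
  have hmarkov : Real.exp (3 * L) * ∑ ξ : PAConfig t m, (if 27 * L ≤ (edgeDeg ξ (t * m) i : ℝ) ∧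
      (edgeDeg ξ n₀ i : ℝ) < L then partialWeight δ (t * m) ξ else 0) ≤
      ∑ ξ, partialWeight δ (t * m) ξ * (Real.exp (θ (t * m) * edgeDeg ξ (t * m) i) * χ ξ) := by
    have hθ : 1 / 9 ≤ θ (t * m) := by
      have hNR : ((t * m : ℕ) : ℝ) ≤ 3 * n₀ := by exact_mod_cast hN
      have hNR' : (n₀ : ℝ) ≤ ((t * m : ℕ) : ℝ) := by exact_mod_cast hle
      have hpos : (0 : ℝ) < ((t * m : ℕ) : ℝ) := hn₀R.trans_le hNR'
      simp only [θ]
      rw [le_div_iff₀ (by positivity)]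
      nlinarith
    rw [Finset.mul_sum]
    refine Finset.sum_le_sum fun ξ _ => ?_
    have hW := partialWeight_nonneg hm hδ (t * m) ξ
    split_ifs with h
    · have h1 : χ ξ = 1 := if_pos h.2
      rw [h1, mul_one, mul_comm]
      refine mul_le_mul_of_nonneg_left (Real.exp_le_exp.2 ?_) hW
      have hD : (0 : ℝ) ≤ edgeDeg ξ (t * m) i := Nat.cast_nonneg _
      nlinarith [h.1, mul_le_mul_of_nonneg_right hθ hD]
    · rw [mul_zero]
      exact mul_nonneg hW (mul_nonneg (Real.exp_pos _).le (hχ₀ ξ))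
  have htpos : (0 : ℝ) < (t : ℝ) ^ k := by
    have : 0 < t := by omega
    positivity
  have hχsum : ∑ ξ, partialWeight δ (t * m) ξ * χ ξ =
      ∑ ξ : PAConfig t m, if (edgeDeg ξ n₀ i : ℝ) < L then partialWeight δ (t * m) ξ else 0 := by
    simp only [χ, mul_ite, mul_one, mul_zero]
  rw [← hχsum]
  have hfinal : Real.exp (3 * L) * ∑ ξ : PAConfig t m, (if 27 * L ≤ (edgeDeg ξ (t * m) i : ℝ) ∧
      (edgeDeg ξ n₀ i : ℝ) < L then partialWeight δ (t * m) ξ else 0) ≤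
      Real.exp L * ∑ ξ, partialWeight δ (t * m) ξ * χ ξ := by
    refine hmarkov.trans (le_of_mul_le_mul_left ?_ htpos)
    refine hmoment.trans (hstart.trans ?_)
    rw [mul_left_comm]
    exact mul_le_mul_of_nonneg_left hmass (Real.exp_pos _).le
  refine le_of_mul_le_mul_left (hfinal.trans_eq ?_) (Real.exp_pos (3 * L))
  rw [← mul_assoc, ← Real.exp_add]
  congr 2
  ring

end

/-- **Old vertices outside the core do not grow too much (Lemma 6.4).**
Fix `σ > 1/(3-τ)` with `τ = 3 + δ/m`. There is a constant `B ∈ (0, ∞)` such that,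
uniformly in `i ∈ [t/2]`,
`P(D_t(i) ≥ (1+B)(log t)^σ | D_{t/2}(i) < (log t)^σ) = o(1/t)`
(the conditional probability is expressed in product form). -/
theorem pa_degree_outside_core (m : ℕ) (hm : 1 ≤ m) (δ : ℝ) (hδ₁ : -(m : ℝ) < δ)
    (hδ₂ : δ < 0) (τ : ℝ) (hτ : τ = 3 + δ / m) (σ : ℝ) (hσ : 1 / (3 - τ) < σ) :
    ∃ B : ℝ, 0 < B ∧ ∀ c : ℝ, 0 < c → ∀ᶠ t : ℕ in atTop, ∀ i : Fin t,
      i.val + 1 ≤ t / 2 →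
      paProb t m δ (fun ξ =>
          (1 + B) * (Real.log t) ^ σ ≤ (paDegT ξ i : ℝ) ∧
          (paDeg ξ (t / 2) m (i.val + 1) : ℝ) < (Real.log t) ^ σ) ≤
        c / t * paProb t m δ (fun ξ =>
          (paDeg ξ (t / 2) m (i.val + 1) : ℝ) < (Real.log t) ^ σ) := by
  have hm' : (0 : ℝ) < m := by exact_mod_cast hm
  have hσ1 : 1 ≤ σ := by
    have h1 : 3 - τ = -(δ / m) := by rw [hτ]; ring
    have h2 : -1 < δ / m := by rw [lt_div_iff₀ hm']; linarith
    have h3 : δ / m < 0 := div_neg_of_neg_of_pos hδ₂ hm'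
    refine le_trans ?_ hσ.le
    rw [h1, le_div_iff₀ (by linarith)]
    linarith
  refine ⟨26, by norm_num, fun c hc => ?_⟩
  filter_upwards [eventually_ge_atTop 3, eventually_ge_atTop ⌈1 / c⌉₊] with t ht htc i hi
  have htR : (3 : ℝ) ≤ t := by exact_mod_cast ht
  have htpos : (0 : ℝ) < t := by linarith
  have hlog : 1 ≤ Real.log t := by
    rw [Real.le_log_iff_exp_le htpos]
    linarith [Real.exp_one_lt_d9]
  have hL : Real.log t ≤ Real.log t ^ σ := by
    simpa using Real.rpow_le_rpow_of_exponent_le hlog hσ1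
  have hprob := paProb_degree_growth_le hm hδ₁ hδ₂.le i hi (Real.log t ^ σ)
  rw [show (1 : ℝ) + 26 = 27 by norm_num]
  refine hprob.trans (mul_le_mul_of_nonneg_right ?_ ?_)
  · calc Real.exp (-(2 * Real.log t ^ σ)) ≤ Real.exp (-Real.log t + -Real.log t) :=
          Real.exp_le_exp.2 (by linarith)
      _ = (t : ℝ)⁻¹ * (t : ℝ)⁻¹ := by
          rw [Real.exp_add, Real.exp_neg, Real.exp_log htpos]
      _ ≤ c * (t : ℝ)⁻¹ := by
          refine mul_le_mul_of_nonneg_right ?_ (by positivity)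
          rw [← one_div, one_div_le htpos hc]
          exact (Nat.le_ceil _).trans (by exact_mod_cast htc)
      _ = c / t := (div_eq_mul_inv _ _).symm
  · refine Finset.sum_nonneg fun ξ _ => ?_
    rw [paWeight_eq_partialWeight]
    exact partialWeight_nonneg hm hδ₁ _ ξ
end
end

section
/- Let (PA_t)_{t≥1} be a preferential attachment model with m ≥ 2 and δ ∈ (−m,0), and set τ = 3 + δ/m. Then for all ζ > 0 and all q > 0 there exists a constant c = c(ζ) such that, with high probability and uniformly in t, for all 1 ≤ x ≤ (log t)^q the empirical tail P_{≥x}(t) = (1/t) Σ_{v∈[t]} 1{D_v(t) ≥ x} satisfies P_{≥x}(t) ≥ c x^{−(τ−1+ζ)}. -/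
open Finset Filter

open scoped Classical

noncomputable section

/-- The position of an edge in the order in which the edges are attached. -/
def edgeIdx {t m : ℕ} (e : Fin t × Fin m) : ℕ := e.1.val * m + e.2.val

/-- The degree of the 0-based vertex `v` after the first `k` edges have been attached. -/
def degAt {t m : ℕ} (ξ : PAConfig t m) (k v : ℕ) : ℕ :=
  ∑ e : Fin t × Fin m,
    if edgeIdx e < k then
      (if (ξ e.1 e.2).val = v then 1 else 0) + (if e.1.val = v then 1 else 0)
    else 0

/-- The normalizing constant of the edge in position `k`. -/
def normC (m : ℕ) (δ : ℝ) (k : ℕ) : ℝ := k * (2 + δ / m) + 1 + δ / m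

/-- The conditional probability that the edge `e` is attached to the vertex `a`. -/
def attachP {t m : ℕ} (δ : ℝ) (ξ : PAConfig t m) (e : Fin t × Fin m) (a : Fin t) : ℝ :=
  if a.val = e.1.val then
    ((degAt ξ (edgeIdx e) e.1.val : ℝ) + 1 + ((e.2.val : ℝ) + 1) * δ / m) / normC m δ (edgeIdx e)
  else if a.val < e.1.val then
    ((degAt ξ (edgeIdx e) a.val : ℝ) + δ) / normC m δ (edgeIdx e)
  else 0

/-- The probability of the first `k` attachment choices of `ξ`. -/
def partialW {t m : ℕ} (δ : ℝ) (ξ : PAConfig t m) (k : ℕ) : ℝ :=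
  ∏ e : Fin t × Fin m, if edgeIdx e < k then attachP δ ξ e (ξ e.1 e.2) else 1

/-- The realization `ξ` with the edge `e` redirected to `a`. -/
def setEdge {t m : ℕ} (ξ : PAConfig t m) (e : Fin t × Fin m) (a : Fin t) : PAConfig t m :=
  fun u j => if (u, j) = e then a else ξ u j

theorem edgeIdx_lt_iff {t m : ℕ} (e : Fin t × Fin m) {u j : ℕ} (hj : j ≤ m) :
    edgeIdx e < u * m + j ↔ e.1.val < u ∨ (e.1.val = u ∧ e.2.val < j) := by
  obtain ⟨⟨a, ha⟩, ⟨b, hb⟩⟩ := e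
  simp only [edgeIdx]
  rcases lt_trichotomy a u with h | h | h
  · have : (a + 1) * m ≤ u * m := Nat.mul_le_mul_right m h
    simp only [h, true_or, iff_true]
    linarith
  · subst h; simp
  · have : (u + 1) * m ≤ a * m := Nat.mul_le_mul_right m h
    have h1 : ¬ a < u := by omega
    have h2 : a ≠ u := by omega
    simp only [h1, h2, false_and, or_self, iff_false, not_lt]
    linarith

theorem edgeIdx_lt {t m : ℕ} (e : Fin t × Fin m) : edgeIdx e < t * m := by
  have := (edgeIdx_lt_iff e (u := t) (j := 0) (Nat.zero_le _)).2 (Or.inl e.1.2)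
  simpa using this

theorem edgeIdx_injective {t m : ℕ} :
    Function.Injective (edgeIdx : Fin t × Fin m → ℕ) := by
  intro e f h
  have h1 := (edgeIdx_lt_iff e (u := f.1.val) (j := f.2.val + 1) f.2.2).1
    (by rw [h]; simp [edgeIdx])
  have h2 := (edgeIdx_lt_iff f (u := e.1.val) (j := e.2.val + 1) e.2.2).1
    (by rw [← h]; simp [edgeIdx])
  ext <;> omega

theorem exists_edgeIdx_eq {t m k : ℕ} (hk : k < t * m) :
    ∃ e : Fin t × Fin m, edgeIdx e = k := by
  have hm : 0 < m := Nat.pos_of_ne_zero fun h => by simp [h] at hk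
  refine ⟨(⟨k / m, (Nat.div_lt_iff_lt_mul hm).2 hk⟩, ⟨k % m, Nat.mod_lt _ hm⟩), ?_⟩
  simp only [edgeIdx]
  exact Nat.div_add_mod' k m

theorem paDeg_eq_degAt {t m : ℕ} (ξ : PAConfig t m) (u v : ℕ) {j : ℕ} (hj : j ≤ m) :
    paDeg ξ (u + 1) j (v + 1) = degAt ξ (u * m + j) v := by
  unfold paDeg degAt
  refine Finset.sum_congr rfl fun e _ => ?_
  have h : (e.1.val + 1 < u + 1 ∨ (e.1.val + 1 = u + 1 ∧ e.2.val + 1 ≤ j)) ↔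
      edgeIdx e < u * m + j := by
    rw [edgeIdx_lt_iff e hj]; omega
  simp only [h]
  simp only [Nat.add_right_cancel_iff]

theorem paDegT_eq_degAt {t m : ℕ} (ξ : PAConfig t m) (v : Fin t) :
    paDegT ξ v = degAt ξ (t * m) v.val := by
  obtain ⟨s, rfl⟩ : ∃ s, t = s + 1 := ⟨t - 1, by have := v.2; omega⟩
  rw [paDegT, paDeg_eq_degAt ξ s v.val le_rfl, Nat.succ_mul]

theorem degAt_succ {t m : ℕ} (ξ : PAConfig t m) (e : Fin t × Fin m) (v : ℕ) :
    degAt ξ (edgeIdx e + 1) v = degAt ξ (edgeIdx e) v +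
      ((if (ξ e.1 e.2).val = v then 1 else 0) + (if e.1.val = v then 1 else 0)) := by
  unfold degAt
  rw [← Finset.add_sum_erase _ _ (Finset.mem_univ e),
    ← Finset.add_sum_erase (a := e) _ _ (Finset.mem_univ e)]
  rw [if_pos (Nat.lt_succ_self _), if_neg (lt_irrefl _), zero_add, add_comm]
  congr 1
  refine Finset.sum_congr rfl fun f hf => ?_
  have hne : edgeIdx f ≠ edgeIdx e := fun h => (Finset.ne_of_mem_erase hf) (edgeIdx_injective h)
  have : edgeIdx f < edgeIdx e + 1 ↔ edgeIdx f < edgeIdx e := by omega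
  simp only [this]

theorem degAt_mono {t m : ℕ} (ξ : PAConfig t m) {k l : ℕ} (h : k ≤ l) (v : ℕ) :
    degAt ξ k v ≤ degAt ξ l v := by
  unfold degAt
  refine Finset.sum_le_sum fun e _ => ?_
  by_cases h1 : edgeIdx e < k
  · rw [if_pos h1, if_pos (h1.trans_le h)]
  · rw [if_neg h1]; exact Nat.zero_le _

theorem degAt_zero {t m : ℕ} (ξ : PAConfig t m) (v : ℕ) : degAt ξ 0 v = 0 := by
  simp [degAt]

theorem le_degAt {t m : ℕ} (ξ : PAConfig t m) (v : Fin t) {j : ℕ} (hj : j ≤ m) :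
    j ≤ degAt ξ (v.val * m + j) v.val := by
  induction j with
  | zero => exact Nat.zero_le _
  | succ j ih =>
    have h := degAt_succ ξ (v, ⟨j, hj⟩) v.val
    simp only [edgeIdx, if_true] at h
    have := ih (by omega)
    rw [← add_assoc, h]
    omega

theorem le_degAt_of_le {t m : ℕ} (ξ : PAConfig t m) (v : Fin t) {k : ℕ}
    (hk : (v.val + 1) * m ≤ k) : m ≤ degAt ξ k v.val := by
  refine (le_degAt ξ v le_rfl).trans (degAt_mono ξ ?_ _)
  linarith

theorem sum_degAt {t m : ℕ} (ξ : PAConfig t m) {k : ℕ} (hk : k ≤ t * m) :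
    ∑ v : Fin t, degAt ξ k v.val = 2 * k := by
  induction k with
  | zero => simp [degAt_zero]
  | succ k ih =>
    obtain ⟨e, rfl⟩ := exists_edgeIdx_eq (Nat.lt_of_succ_le hk)
    simp only [degAt_succ, Finset.sum_add_distrib, ih (by omega), Fin.val_inj]
    simp
    ring

theorem normC_pos {m : ℕ} (hm : 0 < m) {δ : ℝ} (hδ : -(m : ℝ) < δ) (k : ℕ) :
    0 < normC m δ k := by
  have hm' : (0 : ℝ) < m := by exact_mod_cast hm
  have h : -1 < δ / m := by rw [lt_div_iff₀ hm']; linarith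
  unfold normC
  have : (0 : ℝ) ≤ k * (2 + δ / m) := mul_nonneg (Nat.cast_nonneg _) (by linarith)
  linarith

theorem attachP_nonneg {t m : ℕ} (hm : 0 < m) {δ : ℝ} (hδ : -(m : ℝ) < δ)
    (ξ : PAConfig t m) (e : Fin t × Fin m) (a : Fin t) : 0 ≤ attachP δ ξ e a := by
  have hm' : (0 : ℝ) < m := by exact_mod_cast hm
  have h : -1 < δ / m := by rw [lt_div_iff₀ hm']; linarith
  unfold attachP
  split_ifs with h1 h2
  · refine div_nonneg ?_ (normC_pos hm hδ _).le
    have h3 : (e.2.val : ℝ) ≤ degAt ξ (edgeIdx e) e.1.val := by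
      exact_mod_cast le_degAt ξ e.1 e.2.2.le
    rw [mul_div_assoc]
    have : 0 ≤ ((e.2.val : ℝ) + 1) * (1 + δ / m) := by
      apply mul_nonneg <;> [positivity; linarith]
    linarith
  · refine div_nonneg ?_ (normC_pos hm hδ _).le
    have h3 : (m : ℝ) ≤ degAt ξ (edgeIdx e) a.val := by
      refine mod_cast le_degAt_of_le ξ a ?_
      have : (a.val + 1) * m ≤ e.1.val * m := Nat.mul_le_mul_right m h2
      simp only [edgeIdx]; omega
    linarith
  · exact le_rfl

theorem partialW_nonneg {t m : ℕ} (hm : 0 < m) {δ : ℝ} (hδ : -(m : ℝ) < δ)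
    (ξ : PAConfig t m) (k : ℕ) : 0 ≤ partialW δ ξ k := by
  refine Finset.prod_nonneg fun e _ => ?_
  split_ifs
  · exact attachP_nonneg hm hδ _ _ _
  · exact zero_le_one

theorem paWeight_eq_partialW {t m : ℕ} (δ : ℝ) (ξ : PAConfig t m) :
    paWeight t m δ ξ = partialW δ ξ (t * m) := by
  unfold paWeight partialW
  rw [Fintype.prod_prod_type]
  refine Finset.prod_congr rfl fun s _ => Finset.prod_congr rfl fun j _ => ?_
  rw [if_pos (edgeIdx_lt _)]
  have hc : paC m δ (s.val + 1) (j.val + 1) = normC m δ (edgeIdx (s, j)) := by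
    simp only [paC, normC, edgeIdx]; push_cast; ring
  simp only [attachP, hc, paDeg_eq_degAt ξ _ _ j.2.le]
  rfl

theorem partialW_zero {t m : ℕ} (δ : ℝ) (ξ : PAConfig t m) : partialW δ ξ 0 = 1 := by
  simp [partialW]

theorem partialW_succ {t m : ℕ} (δ : ℝ) (ξ : PAConfig t m) (e : Fin t × Fin m) :
    partialW δ ξ (edgeIdx e + 1) = partialW δ ξ (edgeIdx e) * attachP δ ξ e (ξ e.1 e.2) := by
  unfold partialW
  rw [← Finset.mul_prod_erase _ _ (Finset.mem_univ e),
    ← Finset.mul_prod_erase (a := e) _ _ (Finset.mem_univ e)]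
  rw [if_pos (Nat.lt_succ_self _), if_neg (lt_irrefl _), one_mul, mul_comm]
  congr 1
  refine Finset.prod_congr rfl fun f hf => ?_
  have hne : edgeIdx f ≠ edgeIdx e := fun h => (Finset.ne_of_mem_erase hf) (edgeIdx_injective h)
  have : edgeIdx f < edgeIdx e + 1 ↔ edgeIdx f < edgeIdx e := by omega
  simp only [this]

theorem degAt_setEdge {t m : ℕ} (ξ : PAConfig t m) {e : Fin t × Fin m} (a : Fin t) {k : ℕ}
    (hk : k ≤ edgeIdx e) (v : ℕ) : degAt (setEdge ξ e a) k v = degAt ξ k v := by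
  unfold degAt
  refine Finset.sum_congr rfl fun f _ => ?_
  by_cases h : edgeIdx f < k
  · have hne : (f.1, f.2) ≠ e := fun h' => by
      have : f = e := h'
      subst this; omega
    simp only [setEdge, if_neg hne]
  · simp only [if_neg h]

theorem attachP_setEdge {t m : ℕ} (δ : ℝ) (ξ : PAConfig t m) {e f : Fin t × Fin m}
    (h : edgeIdx f ≤ edgeIdx e) (a b : Fin t) :
    attachP δ (setEdge ξ e a) f b = attachP δ ξ f b := by
  simp only [attachP, degAt_setEdge ξ a h]

theorem partialW_setEdge {t m : ℕ} (δ : ℝ) (ξ : PAConfig t m) (e : Fin t × Fin m) (a : Fin t) :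
    partialW δ (setEdge ξ e a) (edgeIdx e) = partialW δ ξ (edgeIdx e) := by
  refine Finset.prod_congr rfl fun f _ => ?_
  by_cases h : edgeIdx f < edgeIdx e
  · have hne : (f.1, f.2) ≠ e := fun h' => by
      have : f = e := h'
      subst this; omega
    rw [attachP_setEdge δ ξ h.le]
    simp only [setEdge, if_neg hne]
  · simp only [if_neg h]

theorem setEdge_apply_self {t m : ℕ} (ξ : PAConfig t m) (e : Fin t × Fin m) (a : Fin t) :
    setEdge ξ e a e.1 e.2 = a := by
  simp [setEdge]

theorem setEdge_setEdge_self {t m : ℕ} (ξ : PAConfig t m) (e : Fin t × Fin m) (a : Fin t) :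
    setEdge (setEdge ξ e a) e (ξ e.1 e.2) = ξ := by
  funext u j
  by_cases h : (u, j) = e
  · subst h; simp [setEdge]
  · simp [setEdge, h]

theorem sum_sum_setEdge {t m : ℕ} (e : Fin t × Fin m) (f : PAConfig t m → ℝ) :
    ∑ ξ, ∑ a, f (setEdge ξ e a) = t * ∑ ξ, f ξ := by
  have h : ∑ z : PAConfig t m × Fin t, f (setEdge z.1 e z.2) =
      ∑ z : PAConfig t m × Fin t, f z.1 := by
    let φ : PAConfig t m × Fin t → PAConfig t m × Fin t :=
      fun z => (setEdge z.1 e z.2, z.1 e.1 e.2)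
    have hφ : Function.Involutive φ := fun z => by
      simp only [φ, setEdge_setEdge_self, setEdge_apply_self]
    exact hφ.bijective.sum_comp (fun z => f z.1)
  rw [Fintype.sum_prod_type, Fintype.sum_prod_type] at h
  rw [h, Finset.mul_sum]
  simp

theorem sum_partialW_succ {t m : ℕ} (δ : ℝ) (e : Fin t × Fin m) (f : PAConfig t m → ℝ) :
    t * ∑ ξ, partialW δ ξ (edgeIdx e + 1) * f ξ =
      ∑ ξ, partialW δ ξ (edgeIdx e) * ∑ a, attachP δ ξ e a * f (setEdge ξ e a) := by
  rw [← sum_sum_setEdge e]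
  refine Finset.sum_congr rfl fun ξ _ => ?_
  rw [Finset.mul_sum]
  refine Finset.sum_congr rfl fun a _ => ?_
  rw [partialW_succ, partialW_setEdge, attachP_setEdge δ ξ le_rfl, setEdge_apply_self, mul_assoc]

theorem target_le_of_partialW_ne_zero {t m : ℕ} {δ : ℝ} {ξ : PAConfig t m} {k : ℕ}
    (h : partialW δ ξ k ≠ 0) {e : Fin t × Fin m} (he : edgeIdx e < k) :
    (ξ e.1 e.2).val ≤ e.1.val := by
  have h1 := (Finset.prod_ne_zero_iff.1 h) e (Finset.mem_univ e)
  rw [if_pos he] at h1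
  by_contra! hlt
  exact h1 (by rw [attachP, if_neg (by omega), if_neg (by omega)])

theorem degAt_eq_zero_of_partialW_ne_zero {t m : ℕ} {δ : ℝ} {ξ : PAConfig t m}
    {e : Fin t × Fin m} (h : partialW δ ξ (edgeIdx e) ≠ 0) {v : ℕ} (hv : e.1.val < v) :
    degAt ξ (edgeIdx e) v = 0 := by
  refine Finset.sum_eq_zero fun f _ => ?_
  split_ifs with h1 h2 h3 h3
  all_goals try rfl
  all_goals
    exfalso
    have h4 := target_le_of_partialW_ne_zero h h1
    have h5 := (edgeIdx_lt_iff f (u := e.1.val) (j := e.2.val) e.2.2.le).1 h1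
    omega

theorem sum_attachP {t m : ℕ} (hm : 0 < m) {δ : ℝ} (hδ : -(m : ℝ) < δ) {ξ : PAConfig t m}
    {e : Fin t × Fin m} (h : partialW δ ξ (edgeIdx e) ≠ 0) : ∑ a, attachP δ ξ e a = 1 := by
  have hm' : (m : ℝ) ≠ 0 := by exact_mod_cast hm.ne'
  have hC := normC_pos hm hδ (edgeIdx e)
  have h1 : ∀ a : Fin t, attachP δ ξ e a = ((degAt ξ (edgeIdx e) a.val : ℝ) +
      (if a = e.1 then 1 + ((e.2.val : ℝ) + 1) * δ / m else 0) +
      (if a < e.1 then δ else 0)) / normC m δ (edgeIdx e) := by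
    intro a
    unfold attachP
    rcases lt_trichotomy a.val e.1.val with h2 | h2 | h2
    · have h3 : a < e.1 := h2
      rw [if_neg h2.ne, if_pos h2, if_neg h3.ne, if_pos h3, add_zero]
    · have h3 : a = e.1 := Fin.ext h2
      rw [if_pos h2, if_pos h3, if_neg (h3 ▸ lt_irrefl _), add_zero, h2, add_assoc]
    · have h3 : e.1 < a := h2
      rw [if_neg h2.ne', if_neg h2.not_gt, if_neg h3.ne', if_neg h3.not_gt,
        degAt_eq_zero_of_partialW_ne_zero h h2]
      simp
  have h2 : ∑ a : Fin t, (degAt ξ (edgeIdx e) a.val : ℝ) = 2 * edgeIdx e := by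
    exact_mod_cast sum_degAt ξ (edgeIdx_lt e).le
  simp only [h1]
  rw [← Finset.sum_div, div_eq_one_iff_eq hC.ne', Finset.sum_add_distrib, Finset.sum_add_distrib,
    h2, ← Finset.sum_filter, ← Finset.sum_filter]
  simp only [Finset.sum_const]
  have h3 : (univ.filter fun a : Fin t => a < e.1).card = e.1.val := by
    rw [← Fin.card_Iio e.1]; congr 1; ext; simp
  rw [h3]
  simp only [Finset.filter_eq', Finset.mem_univ, if_true, Finset.card_singleton, one_smul, normC,
    edgeIdx, nsmul_eq_mul]
  push_cast
  field_simp
  ring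

theorem sum_partialW {t m : ℕ} (hm : 0 < m) {δ : ℝ} (hδ : -(m : ℝ) < δ) {k : ℕ}
    (hk : k ≤ t * m) : (t : ℝ) ^ k * ∑ ξ : PAConfig t m, partialW δ ξ k =
      (t : ℝ) ^ (t * m) := by
  induction k with
  | zero =>
    simp [partialW_zero, ← pow_mul, mul_comm]
  | succ k ih =>
    obtain ⟨e, rfl⟩ := exists_edgeIdx_eq (Nat.lt_of_succ_le hk)
    have h := sum_partialW_succ δ e (fun _ : PAConfig t m => 1)
    simp only [mul_one] at h
    rw [pow_succ, mul_assoc, h, ← ih (by omega)]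
    congr 1
    refine Finset.sum_congr rfl fun ξ _ => ?_
    by_cases h0 : partialW δ ξ (edgeIdx e) = 0
    · rw [h0, zero_mul]
    · rw [sum_attachP hm hδ h0, mul_one]

theorem sum_paWeight {t m : ℕ} (hm : 0 < m) {δ : ℝ} (hδ : -(m : ℝ) < δ) (ht : 0 < t) :
    ∑ ξ : PAConfig t m, paWeight t m δ ξ = 1 := by
  have h := sum_partialW (t := t) hm hδ le_rfl
  simp only [paWeight_eq_partialW]
  exact mul_left_cancel₀ (pow_ne_zero _ (by exact_mod_cast ht.ne')) (h.trans (mul_one _).symm)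

theorem paWeight_nonneg {t m : ℕ} (hm : 0 < m) {δ : ℝ} (hδ : -(m : ℝ) < δ)
    (ξ : PAConfig t m) : 0 ≤ paWeight t m δ ξ := by
  rw [paWeight_eq_partialW]; exact partialW_nonneg hm hδ _ _

/-- The product `∏_{i < n} (1 - p / (y + i))`, a ratio of Gamma functions of order `n ^ (-p)`. -/
def decay (p y : ℝ) (n : ℕ) : ℝ := ∏ i ∈ Finset.range n, (1 - p / (y + i))

theorem decay_factor_pos {p y : ℝ} (hp : 0 < p) (hy : p < y) (i : ℕ) : 0 < 1 - p / (y + i) := by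
  have : (0 : ℝ) ≤ i := Nat.cast_nonneg _
  rw [sub_pos, div_lt_one (by linarith)]
  linarith

theorem decay_pos {p y : ℝ} (hp : 0 < p) (hy : p < y) (n : ℕ) : 0 < decay p y n :=
  Finset.prod_pos fun i _ => decay_factor_pos hp hy i

theorem decay_succ (p y : ℝ) (n : ℕ) : decay p y (n + 1) = decay p y n * (1 - p / (y + n)) :=
  Finset.prod_range_succ _ _

theorem decay_le_one {p y : ℝ} (hp : 0 < p) (hy : p < y) (n : ℕ) : decay p y n ≤ 1 := by
  refine Finset.prod_le_one (fun i _ => (decay_factor_pos hp hy i).le) fun i _ => ?_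
  have : (0 : ℝ) ≤ i := Nat.cast_nonneg _
  have : 0 ≤ p / (y + i) := div_nonneg hp.le (by linarith)
  linarith

theorem rpow_le_decay_succ {p y : ℝ} (hp : 0 < p) (hp1 : p ≤ 1) (hy : p < y) (n : ℕ) :
    (1 - p / y) * (y / (y + n)) ^ p ≤ decay p y (n + 1) := by
  have hy0 : 0 < y := hp.trans hy
  induction n with
  | zero => simp [decay, div_self hy0.ne']
  | succ n ih =>
    have hn : (0 : ℝ) ≤ n := Nat.cast_nonneg _
    have hz : 0 < y + n + 1 := by linarith
    have hstep : ((y + n) / (y + n + 1)) ^ p ≤ 1 - p / (y + n + 1) := by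
      have h1 : -1 ≤ -(1 / (y + n + 1)) := by
        rw [neg_le_neg_iff, div_le_one hz]; linarith
      have hb := rpow_one_add_le_one_add_mul_self h1 hp.le hp1
      have e1 : (y + n) / (y + n + 1) = 1 + -(1 / (y + n + 1)) := by
        field_simp
        ring
      rw [e1]
      refine hb.trans_eq ?_
      ring
    have e : y / (y + (n + 1 : ℕ)) = (y / (y + n)) * ((y + n) / (y + n + 1)) := by
      push_cast
      rw [← add_assoc]
      field_simp
    rw [e, Real.mul_rpow (by positivity) (by positivity), decay_succ, ← mul_assoc]
    push_cast
    rw [← add_assoc]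
    exact mul_le_mul ih hstep (by positivity) (decay_pos hp hy _).le

theorem rpow_le_decay {p y : ℝ} (hp : 0 < p) (hp1 : p ≤ 1) (hy : p < y) (n : ℕ) :
    (1 - p / y) * (y / (y + n)) ^ p ≤ decay p y n := by
  refine (rpow_le_decay_succ hp hp1 hy n).trans ?_
  rw [decay_succ]
  refine mul_le_of_le_one_right (decay_pos hp hy n).le ?_
  have : 0 ≤ p / (y + n) := div_nonneg hp.le (by linarith [(Nat.cast_nonneg n : (0 : ℝ) ≤ n)])
  linarith

/-- The negative-moment functional of the degrees of the vertices in `S`. -/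
def decayProd {t m : ℕ} (p δ : ℝ) (S : Finset (Fin t)) (ξ : PAConfig t m) (k : ℕ) : ℝ :=
  ∏ v ∈ S, decay p (m + δ) (degAt ξ k v.val - m)

theorem decayProd_setEdge {t m : ℕ} {p δ : ℝ} {S : Finset (Fin t)} {ξ : PAConfig t m}
    {e : Fin t × Fin m} (hS : ∀ v ∈ S, v < e.1) (a : Fin t) :
    decayProd p δ S (setEdge ξ e a) (edgeIdx e + 1) = decayProd p δ S ξ (edgeIdx e) *
      (1 - if a ∈ S then p / (degAt ξ (edgeIdx e) a.val + δ) else 0) := by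
  have hm : ∀ v ∈ S, m ≤ degAt ξ (edgeIdx e) v.val := fun v hv => le_degAt_of_le ξ v (by
    have : (v.val + 1) * m ≤ e.1.val * m := Nat.mul_le_mul_right m (hS v hv)
    simp only [edgeIdx]; omega)
  have h1 : ∀ v ∈ S, decay p (m + δ) (degAt (setEdge ξ e a) (edgeIdx e + 1) v.val - m) =
      decay p (m + δ) (degAt ξ (edgeIdx e) v.val - m) *
        if v = a then 1 - p / (degAt ξ (edgeIdx e) v.val + δ) else 1 := by
    intro v hv
    have h2 : e.1.val ≠ v.val := fun h => (hS v hv).ne (Fin.ext h.symm)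
    rw [degAt_succ, degAt_setEdge ξ a le_rfl, setEdge_apply_self, if_neg h2, add_zero]
    by_cases h3 : v = a
    · have := hm v hv
      rw [if_pos (by rw [h3]), if_pos h3, Nat.sub_add_comm this, decay_succ, Nat.cast_sub this]
      congr 3
      ring
    · rw [if_neg (fun h => h3 (Fin.ext h.symm)), if_neg h3, add_zero, mul_one]
  unfold decayProd
  rw [Finset.prod_congr rfl h1, Finset.prod_mul_distrib, Finset.prod_ite_eq']
  congr 1
  split_ifs <;> simp

theorem sum_attachP_decayProd_le {t m : ℕ} (hm : 0 < m) {p δ : ℝ} (hδ : -(m : ℝ) < δ)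
    (hp : 0 < p) (hpδ : p < m + δ) {S : Finset (Fin t)} {ξ : PAConfig t m} {e : Fin t × Fin m}
    (hS : ∀ v ∈ S, v < e.1) (h : partialW δ ξ (edgeIdx e) ≠ 0) :
    ∑ a, attachP δ ξ e a * decayProd p δ S (setEdge ξ e a) (edgeIdx e + 1) ≤
      Real.exp (-(S.card * p / normC m δ (edgeIdx e))) * decayProd p δ S ξ (edgeIdx e) := by
  have hC := normC_pos hm hδ (edgeIdx e)
  have h1 : ∀ a, attachP δ ξ e a * decayProd p δ S (setEdge ξ e a) (edgeIdx e + 1) =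
      decayProd p δ S ξ (edgeIdx e) *
        (attachP δ ξ e a - if a ∈ S then p / normC m δ (edgeIdx e) else 0) := by
    intro a
    rw [decayProd_setEdge hS]
    split_ifs with ha
    · have h2 := hS a ha
      have h3 : (m : ℝ) ≤ degAt ξ (edgeIdx e) a.val := by
        refine mod_cast le_degAt_of_le ξ a ?_
        have : (a.val + 1) * m ≤ e.1.val * m := Nat.mul_le_mul_right m h2
        simp only [edgeIdx]; omega
      have h4 : (degAt ξ (edgeIdx e) a.val : ℝ) + δ ≠ 0 := by linarith
      have h5 : a.val < e.1.val := h2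
      rw [attachP, if_neg h5.ne, if_pos h5]
      field_simp
    · ring
  rw [Finset.sum_congr rfl fun a _ => h1 a, ← Finset.mul_sum, Finset.sum_sub_distrib,
    sum_attachP hm hδ h, Finset.sum_ite_mem, Finset.univ_inter, Finset.sum_const, nsmul_eq_mul,
    mul_comm]
  refine mul_le_mul_of_nonneg_right ?_ (Finset.prod_nonneg fun v _ => (decay_pos hp hpδ _).le)
  have := Real.add_one_le_exp (-(S.card * p / normC m δ (edgeIdx e)))
  rw [← mul_div_assoc]
  linarith

theorem sum_partialW_decayProd_le {t m s : ℕ} (hm : 0 < m) {p δ : ℝ} (hδ : -(m : ℝ) < δ)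
    (hp : 0 < p) (hpδ : p < m + δ) {S : Finset (Fin t)} (hS : ∀ v ∈ S, v.val < s) {k : ℕ}
    (hsk : s * m ≤ k) (hk : k ≤ t * m) :
    (t : ℝ) ^ k * ∑ ξ : PAConfig t m, partialW δ ξ k * decayProd p δ S ξ k ≤
      (t : ℝ) ^ (t * m) * Real.exp (-(S.card * p * ∑ i ∈ Finset.Ico (s * m) k, (normC m δ i)⁻¹)) := by
  induction k, hsk using Nat.le_induction with
  | base =>
    rw [← sum_partialW hm hδ hk]
    simp only [Finset.Ico_self, Finset.sum_empty, mul_zero, neg_zero, Real.exp_zero, mul_one]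
    refine mul_le_mul_of_nonneg_left (Finset.sum_le_sum fun ξ _ => ?_) (by positivity)
    refine mul_le_of_le_one_right (partialW_nonneg hm hδ _ _) ?_
    exact Finset.prod_le_one (fun v _ => (decay_pos hp hpδ _).le) fun v _ => decay_le_one hp hpδ _
  | succ k hsk ih =>
    obtain ⟨e, rfl⟩ := exists_edgeIdx_eq (Nat.lt_of_succ_le hk)
    have hse : s ≤ e.1.val := by
      by_contra! hlt
      have h1 := (edgeIdx_lt_iff e (u := s) (j := 0) (Nat.zero_le _)).2 (Or.inl hlt)
      omega
    have hS' : ∀ v ∈ S, v < e.1 := fun v hv => Fin.lt_def.2 ((hS v hv).trans_le hse)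
    rw [pow_succ, mul_assoc, sum_partialW_succ δ e]
    have h1 : ∑ ξ : PAConfig t m, partialW δ ξ (edgeIdx e) *
        ∑ a, attachP δ ξ e a * decayProd p δ S (setEdge ξ e a) (edgeIdx e + 1) ≤
        Real.exp (-(S.card * p / normC m δ (edgeIdx e))) *
          ∑ ξ : PAConfig t m, partialW δ ξ (edgeIdx e) * decayProd p δ S ξ (edgeIdx e) := by
      rw [Finset.mul_sum]
      refine Finset.sum_le_sum fun ξ _ => ?_
      by_cases h0 : partialW δ ξ (edgeIdx e) = 0
      · simp [h0]
      · rw [mul_left_comm]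
        exact mul_le_mul_of_nonneg_left (sum_attachP_decayProd_le hm hδ hp hpδ hS' h0)
          (partialW_nonneg hm hδ _ _)
    refine (mul_le_mul_of_nonneg_left h1 (by positivity)).trans ?_
    rw [mul_left_comm]
    refine (mul_le_mul_of_nonneg_left (ih (by omega)) (Real.exp_pos _).le).trans_eq ?_
    rw [mul_left_comm, ← Real.exp_add, Finset.sum_Ico_succ_top hsk]
    congr 2
    ring

theorem paExp_decayProd_le {t m s : ℕ} (hm : 0 < m) {p δ : ℝ} (hδ : -(m : ℝ) < δ)
    (hp : 0 < p) (hpδ : p < m + δ) (ht : 0 < t) (hst : s ≤ t) {S : Finset (Fin t)}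
    (hS : ∀ v ∈ S, v.val < s) :
    paExp t m δ (fun ξ => decayProd p δ S ξ (t * m)) ≤
      Real.exp (-(p * ∑ i ∈ Finset.Ico (s * m) (t * m), (normC m δ i)⁻¹)) ^ S.card := by
  have h := sum_partialW_decayProd_le hm hδ hp hpδ hS (Nat.mul_le_mul_right m hst) le_rfl
  unfold paExp
  simp only [paWeight_eq_partialW]
  rw [← Real.exp_nat_mul]
  refine (le_of_mul_le_mul_left h (by positivity)).trans_eq ?_
  congr 1
  ring

theorem log_le_sum_inv_normC {t m s : ℕ} (hm : 0 < m) {δ : ℝ} (hδ : -(m : ℝ) < δ)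
    (hst : s ≤ t) (ht : 0 < t) :
    (2 + δ / m)⁻¹ * Real.log (t / (s + 1)) ≤
      ∑ i ∈ Finset.Ico (s * m) (t * m), (normC m δ i)⁻¹ := by
  have hm' : (0 : ℝ) < m := by exact_mod_cast hm
  have hm1 : (1 : ℝ) ≤ m := by exact_mod_cast hm
  have ht' : (0 : ℝ) < t := by exact_mod_cast ht
  have hχ : -1 < δ / m := by rw [lt_div_iff₀ hm']; linarith
  have h1 : ∀ i : ℕ, (2 + δ / m)⁻¹ * (Real.log ((i + 1 : ℕ) + 1) - Real.log (i + 1)) ≤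
      (normC m δ i)⁻¹ := by
    intro i
    have hi : (0 : ℝ) < (i : ℝ) + 1 := by positivity
    have h2 : Real.log ((i + 1 : ℕ) + 1) - Real.log (i + 1) ≤ ((i : ℝ) + 1)⁻¹ := by
      push_cast
      rw [← Real.log_div (by positivity) (by positivity)]
      refine (Real.log_le_sub_one_of_pos (by positivity)).trans_eq ?_
      field_simp
      ring
    refine (mul_le_mul_of_nonneg_left h2 (inv_nonneg.2 (by linarith))).trans ?_
    rw [← mul_inv]
    refine inv_anti₀ (normC_pos hm hδ i) ?_
    unfold normC
    linarith
  have h3 : ∑ i ∈ Finset.Ico (s * m) (t * m),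
      (Real.log ((i + 1 : ℕ) + 1) - Real.log (i + 1)) =
      Real.log ((t * m : ℕ) + 1) - Real.log ((s * m : ℕ) + 1) :=
    Finset.sum_Ico_sub (fun i : ℕ => Real.log ((i : ℝ) + 1)) (Nat.mul_le_mul_right m hst)
  refine le_trans ?_ (Finset.sum_le_sum fun i _ => h1 i)
  rw [← Finset.mul_sum, h3]
  refine mul_le_mul_of_nonneg_left ?_ (inv_nonneg.2 (by linarith))
  push_cast
  rw [← Real.log_div (by positivity) (by positivity)]
  refine Real.log_le_log (by positivity) ?_
  rw [div_le_div_iff₀ (by positivity) (by positivity)]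
  nlinarith [mul_nonneg ht'.le (sub_nonneg.2 hm1)]

theorem paProb_compl {t m : ℕ} (hm : 0 < m) {δ : ℝ} (hδ : -(m : ℝ) < δ) (ht : 0 < t)
    (E : PAConfig t m → Prop) : paProb t m δ E = 1 - paProb t m δ (fun ξ => ¬ E ξ) := by
  unfold paProb
  rw [eq_sub_iff_add_eq, Finset.sum_filter_add_sum_filter_not, sum_paWeight hm hδ ht]

theorem paProb_nonneg {t m : ℕ} (hm : 0 < m) {δ : ℝ} (hδ : -(m : ℝ) < δ)
    (E : PAConfig t m → Prop) : 0 ≤ paProb t m δ E :=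
  Finset.sum_nonneg fun ξ _ => paWeight_nonneg hm hδ ξ

theorem paProb_le_paExp {t m : ℕ} (hm : 0 < m) {δ : ℝ} (hδ : -(m : ℝ) < δ)
    {E : PAConfig t m → Prop} {f : PAConfig t m → ℝ} (hf : ∀ ξ, 0 ≤ f ξ)
    (hE : ∀ ξ, E ξ → 1 ≤ f ξ) : paProb t m δ E ≤ paExp t m δ f := by
  unfold paProb paExp
  rw [Finset.sum_filter]
  refine Finset.sum_le_sum fun ξ _ => ?_
  have hw := paWeight_nonneg hm hδ ξ
  split_ifs with h
  · exact le_mul_of_one_le_right hw (hE ξ h)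
  · exact mul_nonneg hw (hf ξ)

/-- If `t / (s + 1)` exceeds a constant times `k ^ (2 + δ / m)`, then it is exponentially unlikely
in `s` that at least half of the first `s` vertices have degree less than `k` at time `t`. -/
theorem paProb_low_degree_le {t m s k : ℕ} (hm : 0 < m) {p δ : ℝ} (hδ : -(m : ℝ) < δ)
    (hp : 0 < p) (hp1 : p ≤ 1) (hpδ : p < m + δ) (ht : 0 < t) (hst : s ≤ t)
    (hk : 1 ≤ k)
    (hs : ((15 / (1 - p / (m + δ))) ^ p⁻¹ * ((m + δ + 1) / (m + δ)) * k) ^ (2 + δ / m) ≤ (t : ℝ) / (s + 1)) :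
    paProb t m δ (fun ξ => s ≤ 2 * (univ.filter fun v : Fin t =>
      v.val < s ∧ degAt ξ (t * m) v.val < k).card) ≤ ((2 : ℝ) ^ s)⁻¹ := by
  have hm' : (0 : ℝ) < m := by exact_mod_cast hm
  have ht' : (0 : ℝ) < t := by exact_mod_cast ht
  have hk' : (1 : ℝ) ≤ k := by exact_mod_cast hk
  have hχ : -1 < δ / m := by rw [lt_div_iff₀ hm']; linarith
  set b : ℝ := Real.exp (-(p * ∑ i ∈ Finset.Ico (s * m) (t * m), (normC m δ i)⁻¹)) with hb
  set α : ℝ := m + δ with hα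
  set κ : ℝ := 1 - p / α with hκ
  have hα0 : 0 < α := by rw [hα]; linarith
  have hκ0 : 0 < κ := by rw [hκ, sub_pos, div_lt_one hα0]; exact hpδ
  have hb0 : 0 < b := Real.exp_pos _
  have hA : (0 : ℝ) < (15 / κ) ^ p⁻¹ * ((α + 1) / α) * k := by positivity
  have hbb : b ≤ ((15 / κ) ^ p⁻¹ * ((α + 1) / α) * k) ^ (-p) := by
    rw [Real.rpow_def_of_pos hA, hb, Real.exp_le_exp]
    have h1 := log_le_sum_inv_normC hm hδ hst ht
    have h2 := Real.log_le_log (by positivity) hs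
    rw [Real.log_rpow hA] at h2
    have h3 : Real.log ((15 / κ) ^ p⁻¹ * ((α + 1) / α) * k) ≤
        (2 + δ / m)⁻¹ * Real.log (t / (s + 1)) := by
      rw [inv_mul_eq_div, le_div_iff₀ (by linarith)]
      linarith
    nlinarith [mul_le_mul_of_nonneg_left (h3.trans h1) hp.le]
  have hbad : ∀ n : ℕ, n < k → 15 * b ≤ decay p α (n - m) := by
    intro n hn
    refine le_trans ?_ (rpow_le_decay hp hp1 hpδ (n - m))
    have hn' : ((n - m : ℕ) : ℝ) ≤ k := by exact_mod_cast (Nat.sub_le _ _).trans hn.le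
    have h1 : α / ((α + 1) * k) ≤ α / (α + (n - m : ℕ)) := by
      refine div_le_div_of_nonneg_left hα0.le (by positivity) ?_
      nlinarith
    refine le_trans ?_ (mul_le_mul_of_nonneg_left
      (Real.rpow_le_rpow (by positivity) h1 hp.le) hκ0.le)
    refine (mul_le_mul_of_nonneg_left hbb (by norm_num)).trans_eq ?_
    have e : (15 / κ) ^ p⁻¹ * ((α + 1) / α) * k = (15 / κ) ^ p⁻¹ * (α / ((α + 1) * k))⁻¹ := by
      field_simp
    rw [e, Real.mul_rpow (by positivity) (by positivity), ← Real.rpow_mul (by positivity),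
      Real.inv_rpow (by positivity), ← Real.rpow_neg (by positivity), neg_neg, mul_neg,
      inv_mul_cancel₀ hp.ne', Real.rpow_neg_one, ← mul_assoc]
    congr 1
    rw [inv_div, mul_div_cancel₀ _ (by norm_num)]
  set V : Finset (Fin t) := univ.filter fun v => v.val < s with hV
  have hVc : V.card = s := by
    rw [hV, Fin.card_filter_val_lt]; omega
  set f : PAConfig t m → ℝ := fun ξ =>
    (4 ^ s)⁻¹ * ∏ v ∈ V, (1 + b⁻¹ * decay p α (degAt ξ (t * m) v.val - m)) with hf
  have hd : ∀ n, 0 < decay p α n := decay_pos hp hpδ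
  refine (paProb_le_paExp hm hδ (f := f) (fun ξ => ?_) (fun ξ hξ => ?_)).trans ?_
  · exact mul_nonneg (by positivity) (Finset.prod_nonneg fun v _ =>
      add_nonneg zero_le_one (mul_nonneg (by positivity) (hd _).le))
  · simp only [hf]
    rw [← div_eq_inv_mul, one_le_div (by positivity)]
    set B : Finset (Fin t) := univ.filter fun v : Fin t =>
      v.val < s ∧ degAt ξ (t * m) v.val < k with hB
    have hBV : B ⊆ V := fun v hv => by
      simp only [hB, hV, Finset.mem_filter, Finset.mem_univ, true_and] at hv ⊢
      exact hv.1
    calc (4 : ℝ) ^ s ≤ 4 ^ (2 * B.card) := pow_le_pow_right₀ (by norm_num) hξ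
      _ = ∏ v ∈ B, (16 : ℝ) := by rw [pow_mul, Finset.prod_const]; norm_num
      _ ≤ ∏ v ∈ B, (1 + b⁻¹ * decay p α (degAt ξ (t * m) v.val - m)) := by
        refine Finset.prod_le_prod (fun _ _ => by norm_num) fun v hv => ?_
        have h1 := hbad (degAt ξ (t * m) v.val) (by
          simp only [hB, Finset.mem_filter] at hv; exact hv.2.2)
        have : 15 ≤ b⁻¹ * decay p α (degAt ξ (t * m) v.val - m) := by
          rwa [← div_eq_inv_mul, le_div_iff₀ hb0]
        linarith
      _ ≤ _ := by
        refine Finset.prod_le_prod_of_subset_of_one_le hBV (fun v _ => ?_) fun v _ _ => ?_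
        · exact add_nonneg zero_le_one (mul_nonneg (by positivity) (hd _).le)
        · exact le_add_of_nonneg_right (mul_nonneg (by positivity) (hd _).le)
  · have h1 : paExp t m δ f = (4 ^ s)⁻¹ * ∑ S ∈ V.powerset, (b⁻¹) ^ S.card *
        paExp t m δ (fun ξ => decayProd p δ S ξ (t * m)) := by
      simp only [paExp, hf, Finset.prod_one_add, decayProd, Finset.prod_mul_distrib,
        Finset.prod_const, Finset.mul_sum]
      rw [Finset.sum_comm]
      refine Finset.sum_congr rfl fun S _ => Finset.sum_congr rfl fun ξ _ => ?_
      ring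
    have h2 : ∑ S ∈ V.powerset, (b⁻¹) ^ S.card *
        paExp t m δ (fun ξ => decayProd p δ S ξ (t * m)) ≤ ∑ S ∈ V.powerset, (1 : ℝ) := by
      refine Finset.sum_le_sum fun S hS => ?_
      have h3 := paExp_decayProd_le hm hδ hp hpδ ht hst (S := S) (fun v hv => by
        have := Finset.mem_powerset.1 hS hv
        simpa [hV] using this)
      refine (mul_le_mul_of_nonneg_left h3 (by positivity)).trans_eq ?_
      rw [← mul_pow, inv_mul_cancel₀ hb0.ne', one_pow]
    rw [h1]
    refine (mul_le_mul_of_nonneg_left h2 (by positivity)).trans_eq ?_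
    rw [Finset.sum_const, Finset.card_powerset, hVc, nsmul_eq_mul, mul_one]
    push_cast
    rw [show (4 : ℝ) = 2 * 2 by norm_num, mul_pow]
    field_simp

theorem paProb_mono {t m : ℕ} (hm : 0 < m) {δ : ℝ} (hδ : -(m : ℝ) < δ)
    {E F : PAConfig t m → Prop} (h : ∀ ξ, E ξ → F ξ) : paProb t m δ E ≤ paProb t m δ F := by
  refine Finset.sum_le_sum_of_subset_of_nonneg (fun ξ hξ => ?_)
    fun ξ _ _ => paWeight_nonneg hm hδ ξ
  simp only [Finset.mem_filter, Finset.mem_univ, true_and] at hξ ⊢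
  exact h ξ hξ

theorem paProb_exists_le {t m : ℕ} (hm : 0 < m) {δ : ℝ} (hδ : -(m : ℝ) < δ) (I : Finset ℕ)
    (E : ℕ → PAConfig t m → Prop) :
    paProb t m δ (fun ξ => ∃ k ∈ I, E k ξ) ≤ ∑ k ∈ I, paProb t m δ (E k) := by
  unfold paProb
  simp only [Finset.sum_filter]
  rw [Finset.sum_comm]
  refine Finset.sum_le_sum fun ξ _ => ?_
  have hw := paWeight_nonneg hm hδ ξ
  have h0 : ∀ k ∈ I, 0 ≤ if E k ξ then paWeight t m δ ξ else 0 := fun k _ => by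
    split_ifs <;> simp [hw]
  split_ifs with h
  · obtain ⟨k, hk, hE⟩ := h
    have := Finset.single_le_sum h0 hk
    rwa [if_pos hE] at this
  · exact Finset.sum_nonneg h0

theorem exists_paProb_card_lt_le {m : ℕ} (hm : 0 < m) {δ : ℝ} (hδ : -(m : ℝ) < δ) :
    ∃ A : ℝ, 1 ≤ A ∧ ∀ t k : ℕ, 1 ≤ k → 2 * (A * k) ^ (2 + δ / m) ≤ t →
      paProb t m δ (fun ξ => ((univ.filter fun v : Fin t => k ≤ degAt ξ (t * m) v.val).card : ℝ) <
        t / (8 * (A * k) ^ (2 + δ / m))) ≤ 2 * (A * k) ^ (2 + δ / m) / t := by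
  have hm' : (0 : ℝ) < m := by exact_mod_cast hm
  have hχ : -1 < δ / m := by rw [lt_div_iff₀ hm']; linarith
  obtain ⟨p, hp, hp1, hpδ⟩ : ∃ p : ℝ, 0 < p ∧ p ≤ 1 ∧ p < m + δ := by
    have h0 : 0 < m + δ := by linarith
    rcases le_total 1 (m + δ) with h | h
    · exact ⟨1 / 2, by norm_num, by norm_num, by linarith⟩
    · exact ⟨(m + δ) / 2, by linarith, by linarith, by linarith⟩
  have h0 : 0 < m + δ := by linarith
  have hκ : 0 < 1 - p / (m + δ) := by rw [sub_pos, div_lt_one h0]; exact hpδ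
  refine ⟨(15 / (1 - p / (m + δ))) ^ p⁻¹ * ((m + δ + 1) / (m + δ)), ?_, ?_⟩
  · refine one_le_mul_of_one_le_of_one_le (Real.one_le_rpow ?_ (by positivity)) ?_
    · rw [one_le_div hκ]
      have : 0 ≤ p / (m + δ) := by positivity
      linarith
    · rw [one_le_div h0]; linarith
  intro t k hk ht
  have hk' : (1 : ℝ) ≤ k := by exact_mod_cast hk
  set X : ℝ := ((15 / (1 - p / (m + δ))) ^ p⁻¹ * ((m + δ + 1) / (m + δ)) * k) ^ (2 + δ / m)
    with hX
  have hX1 : 1 ≤ X := by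
    refine Real.one_le_rpow ?_ (by linarith)
    refine one_le_mul_of_one_le_of_one_le ?_ hk'
    refine one_le_mul_of_one_le_of_one_le (Real.one_le_rpow ?_ (by positivity)) ?_
    · rw [one_le_div hκ]
      have : 0 ≤ p / (m + δ) := by positivity
      linarith
    · rw [one_le_div h0]; linarith
  have hX0 : 0 < X := by linarith
  have ht0 : (0 : ℝ) < t := by linarith
  have hy2 : 2 ≤ t / X := by rw [le_div_iff₀ hX0]; exact ht
  have hfl : 2 ≤ ⌊(t : ℝ) / X⌋₊ := Nat.le_floor (by exact_mod_cast hy2)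
  obtain ⟨s, hs⟩ : ∃ s, ⌊(t : ℝ) / X⌋₊ = s + 1 := ⟨⌊(t : ℝ) / X⌋₊ - 1, by omega⟩
  have hs1 : 1 ≤ s := by omega
  have hs1' : (1 : ℝ) ≤ s := by exact_mod_cast hs1
  have hsle : (s : ℝ) + 1 ≤ t / X := by
    have := Nat.floor_le (a := (t : ℝ) / X) (by positivity)
    rw [hs] at this; exact_mod_cast this
  have hslt : (t : ℝ) / X < s + 2 := by
    have := Nat.lt_floor_add_one ((t : ℝ) / X)
    rw [hs] at this; push_cast at this; linarith
  have hst : s ≤ t := by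
    have h1 : (t : ℝ) / X ≤ t := div_le_self ht0.le hX1
    have : (s : ℝ) ≤ t := by linarith
    exact_mod_cast this
  have hmain := paProb_low_degree_le (t := t) (s := s) (k := k) hm hδ hp hp1 hpδ
    (by exact_mod_cast ht0) hst hk (by
      rw [← hX, le_div_iff₀ (by positivity), mul_comm]
      exact (le_div_iff₀ hX0).1 hsle)
  refine ((paProb_mono hm hδ fun ξ hξ => ?_).trans hmain).trans ?_
  · have h1 : (univ.filter fun v : Fin t => v.val < s).card = s := by
      rw [Fin.card_filter_val_lt]; omega
    have h2 : (univ.filter fun v : Fin t => v.val < s) ⊆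
        (univ.filter fun v : Fin t => k ≤ degAt ξ (t * m) v.val) ∪
        (univ.filter fun v : Fin t => v.val < s ∧ degAt ξ (t * m) v.val < k) := by
      intro v hv
      simp only [Finset.mem_filter, Finset.mem_univ, true_and, Finset.mem_union] at hv ⊢
      rcases le_or_gt k (degAt ξ (t * m) v.val) with h | h
      · exact Or.inl h
      · exact Or.inr ⟨hv, h⟩
    have h3 := (Finset.card_le_card h2).trans (Finset.card_union_le _ _)
    rw [h1] at h3
    have h4 : (t : ℝ) / (8 * X) = t / X / 8 := by rw [div_div, mul_comm]
    rw [h4] at hξ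
    have h5 : (s : ℝ) ≤ (univ.filter fun v : Fin t => k ≤ degAt ξ (t * m) v.val).card +
      (univ.filter fun v : Fin t => v.val < s ∧ degAt ξ (t * m) v.val < k).card := by
      exact_mod_cast h3
    have h6 : (s : ℝ) ≤ 2 *
      (univ.filter fun v : Fin t => v.val < s ∧ degAt ξ (t * m) v.val < k).card := by linarith
    exact_mod_cast h6
  · have h1 : ((s + 1 : ℕ) : ℝ) ≤ 2 ^ s := by exact_mod_cast Nat.lt_two_pow_self
    refine (inv_anti₀ (by positivity) h1).trans ?_
    rw [inv_le_iff_one_le_mul₀ (by positivity)]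
    push_cast
    rw [div_mul_eq_mul_div, one_le_div ht0]
    have := (div_lt_iff₀ hX0).1 hslt
    nlinarith

theorem tendsto_log_rpow_pow_div (q C : ℝ) :
    Tendsto (fun t : ℕ => C * (Real.log t ^ q) ^ 3 / t) atTop (nhds 0) := by
  have h := (isLittleO_log_rpow_rpow_atTop (q * 3) (zero_lt_one (α := ℝ))).tendsto_div_nhds_zero
  have h2 := (h.const_mul C).comp tendsto_natCast_atTop_atTop
  rw [mul_zero] at h2
  refine h2.congr' ?_
  filter_upwards [eventually_ge_atTop 1] with t ht
  have hl : 0 ≤ Real.log t := Real.log_nonneg (by exact_mod_cast ht)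
  simp only [Function.comp, Real.rpow_one]
  rw [Real.rpow_mul hl, mul_div_assoc]
  norm_cast

/-- **Tail of the empirical degree distribution of `PA_t` (Lemma 6.15).**
For `m ≥ 2`, `δ ∈ (-m, 0)` and `τ = 3 + δ/m`: for every `ζ > 0` and `q > 0` there is a
constant `c = c(ζ) > 0` such that, with high probability, for all `1 ≤ x ≤ (log t)^q`
the empirical tail satisfies `P_{≥x}(t) = (1/t) ∑_v 1{D_v(t) ≥ x} ≥ c x^{-(τ-1+ζ)}`. -/
theorem pa_empirical_tail (m : ℕ) (hm : 2 ≤ m) (δ : ℝ) (hδ₁ : -(m : ℝ) < δ)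
    (hδ₂ : δ < 0) (τ : ℝ) (hτ : τ = 3 + δ / m)
    (ζ : ℝ) (hζ : 0 < ζ) (q : ℝ) (hq : 0 < q) :
    ∃ c : ℝ, 0 < c ∧
      Tendsto (fun t : ℕ =>
          paProb t m δ (fun ξ => ∀ x : ℝ, 1 ≤ x → x ≤ (Real.log t) ^ q →
            c * x ^ (-(τ - 1 + ζ)) ≤
              (((univ : Finset (Fin t)).filter
                  (fun v => x ≤ (paDegT ξ v : ℝ))).card : ℝ) / t))
        atTop (nhds 1) := by
  have hm0 : 0 < m := by omega
  have hm' : (0 : ℝ) < m := by exact_mod_cast hm0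
  have hχ : -1 < δ / m := by rw [lt_div_iff₀ hm']; linarith
  have hχ' : δ / m < 0 := div_neg_of_neg_of_pos hδ₂ hm'
  obtain ⟨A, hA1, hA⟩ := exists_paProb_card_lt_le hm0 hδ₁
  have hθ : τ - 1 = 2 + δ / m := by rw [hτ]; ring
  rw [hθ]
  set θ : ℝ := 2 + δ / m with hθdef
  have hθ1 : 0 < θ := by linarith
  have hA0 : 0 < A := by linarith
  refine ⟨(8 * (2 * A) ^ θ)⁻¹, by positivity, ?_⟩
  have hε := tendsto_log_rpow_pow_div q (16 * A ^ 2)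
  have hlim : Tendsto (fun t : ℕ => 1 - 16 * A ^ 2 * (Real.log t ^ q) ^ 3 / t) atTop (nhds 1) := by
    simpa using hε.const_sub 1
  have hlog : ∀ᶠ t : ℕ in atTop, 1 ≤ Real.log t :=
    (Real.tendsto_log_atTop.comp tendsto_natCast_atTop_atTop).eventually_ge_atTop 1
  refine tendsto_of_tendsto_of_tendsto_of_le_of_le' hlim tendsto_const_nhds ?_ ?_
  · filter_upwards [hlog, eventually_ge_atTop 1, hε.eventually_le_const zero_lt_one]
      with t hlt ht hε1
    have ht0 : (0 : ℝ) < t := by exact_mod_cast ht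
    set Λ : ℝ := Real.log t ^ q with hΛ
    have hΛ1 : 1 ≤ Λ := Real.one_le_rpow hlt hq.le
    have hceil : ∀ x : ℝ, 1 ≤ x → (⌈x⌉₊ : ℝ) ≤ 2 * x := fun x hx => by
      have := Nat.ceil_lt_add_one (a := x) (by linarith)
      linarith
    have hpow : ∀ k ∈ Finset.Icc 1 ⌈Λ⌉₊, (A * (k : ℝ)) ^ θ ≤ 4 * A ^ 2 * Λ ^ 2 := by
      intro k hk
      rw [Finset.mem_Icc] at hk
      have h1 : (1 : ℝ) ≤ k := by exact_mod_cast hk.1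
      have h2 : (k : ℝ) ≤ 2 * Λ := by
        have : (k : ℝ) ≤ ⌈Λ⌉₊ := by exact_mod_cast hk.2
        exact this.trans (hceil Λ hΛ1)
      have h3 : (A * (k : ℝ)) ^ θ ≤ (A * (k : ℝ)) ^ (2 : ℝ) :=
        Real.rpow_le_rpow_of_exponent_le (one_le_mul_of_one_le_of_one_le hA1 h1) (by linarith)
      have h4 : (A * (k : ℝ)) ^ 2 ≤ (A * (2 * Λ)) ^ 2 := by gcongr
      rw [Real.rpow_two] at h3
      nlinarith
    have hsmall : 16 * A ^ 2 * Λ ^ 3 ≤ t := by rwa [div_le_one ht0] at hε1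
    have hΛ23 : Λ ^ 2 ≤ Λ ^ 3 := pow_le_pow_right₀ hΛ1 (by norm_num)
    have hAA : 0 ≤ A ^ 2 := by positivity
    rw [paProb_compl hm0 hδ₁ ht]
    refine sub_le_sub_left ?_ 1
    refine le_trans (paProb_mono hm0 hδ₁ (F := fun ξ => ∃ k ∈ Finset.Icc 1 ⌈Λ⌉₊,
      ((univ.filter fun v : Fin t => k ≤ degAt ξ (t * m) v.val).card : ℝ) <
        t / (8 * (A * k) ^ θ)) fun ξ hξ => ?_) ?_
    · contrapose! hξ
      intro x hx1 hx2
      have hk : ⌈x⌉₊ ∈ Finset.Icc 1 ⌈Λ⌉₊ :=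
        Finset.mem_Icc.2 ⟨Nat.one_le_ceil_iff.2 (by linarith), Nat.ceil_mono hx2⟩
      have h1 := hξ _ hk
      have hx0 : 0 < x := by linarith
      have h2 : ((univ.filter fun v : Fin t => ⌈x⌉₊ ≤ degAt ξ (t * m) v.val)) =
          (univ.filter fun v : Fin t => x ≤ (paDegT ξ v : ℝ)) := by
        ext v
        simp only [Finset.mem_filter, Finset.mem_univ, true_and, paDegT_eq_degAt, Nat.ceil_le]
      rw [h2] at h1
      rw [le_div_iff₀ ht0]
      refine le_trans ?_ h1
      have h3 : x ^ (-(θ + ζ)) ≤ x ^ (-θ) :=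
        Real.rpow_le_rpow_of_exponent_le hx1 (by linarith)
      have hk1 : (1 : ℝ) ≤ ⌈x⌉₊ := by exact_mod_cast (Finset.mem_Icc.1 hk).1
      have h4 : (A * (⌈x⌉₊ : ℝ)) ^ θ ≤ (2 * A) ^ θ * x ^ θ := by
        rw [← Real.mul_rpow (by positivity) hx0.le]
        refine Real.rpow_le_rpow (by positivity) ?_ hθ1.le
        nlinarith [hceil x hx1]
      calc (8 * (2 * A) ^ θ)⁻¹ * x ^ (-(θ + ζ)) * t ≤ (8 * (2 * A) ^ θ)⁻¹ * x ^ (-θ) * t := by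
            gcongr
        _ = t / (8 * ((2 * A) ^ θ * x ^ θ)) := by
            rw [Real.rpow_neg hx0.le]
            field_simp
        _ ≤ t / (8 * (A * (⌈x⌉₊ : ℝ)) ^ θ) := by gcongr
    · refine (paProb_exists_le hm0 hδ₁ _ _).trans ?_
      have h1 : ∀ k ∈ Finset.Icc 1 ⌈Λ⌉₊, paProb t m δ (fun ξ =>
          ((univ.filter fun v : Fin t => k ≤ degAt ξ (t * m) v.val).card : ℝ) <
            t / (8 * (A * k) ^ θ)) ≤ 8 * A ^ 2 * Λ ^ 2 / t := by
        intro k hk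
        have h2 := hpow k hk
        refine (hA t k (Finset.mem_Icc.1 hk).1 (by nlinarith)).trans ?_
        exact div_le_div_of_nonneg_right (by linarith) ht0.le
      refine (Finset.sum_le_card_nsmul _ _ _ h1).trans ?_
      rw [Nat.card_Icc, Nat.add_sub_cancel, nsmul_eq_mul]
      refine (mul_le_mul_of_nonneg_right (hceil Λ hΛ1) (by positivity)).trans_eq ?_
      ring
  · filter_upwards [eventually_ge_atTop 1] with t ht
    rw [paProb_compl hm0 hδ₁ ht]
    linarith [paProb_nonneg hm0 hδ₁ (t := t) (fun ξ : PAConfig t m => ¬ ∀ x : ℝ, 1 ≤ x →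
      x ≤ (Real.log t) ^ q → (8 * (2 * A) ^ θ)⁻¹ * x ^ (-(θ + ζ)) ≤
        (((univ : Finset (Fin t)).filter (fun v => x ≤ (paDegT ξ v : ℝ))).card : ℝ) / t)]
end
end
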